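/- arXiv:2403.10661 — 2 statements merged into one kernel-verified Lean document; each statement's English description precedes it below -/
import Mathlib

section
/- Let V ⊆ A^n be a smooth irreducible variety of dimension d. Then TV ⊆ A^{2n} is a smooth irreducible variety of dimension 2d; moreover, if I(V) = (f₁,…,f_r) ⊆ K[x₁,…,x_n], then I(TV) = (f₁,…,f_r, ∇f₁·y, …, ∇f_r·y) ⊆ K[x₁,…,x_n, y₁,…,y_n], where y₁,…,y_n are new indeterminates. -/
open MvPolynomial

/-- A subset of affine space is an algebraic set if it is the zero locus of an
ideal of polynomials. -/
def IsAlgebraicSet {K : Type} [Field K] {n : ℕ} (W : Set (Fin n → K)) : Prop :=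
  ∃ I : Ideal (MvPolynomial (Fin n) K), W = zeroLocus K I

/-- An irreducible affine variety: an algebraic set whose vanishing ideal is prime. -/
def IsIrreducibleVariety {K : Type} [Field K] {n : ℕ} (W : Set (Fin n → K)) : Prop :=
  IsAlgebraicSet W ∧ (vanishingIdeal K W).IsPrime

/-- The dimension of an affine algebraic set: the Krull dimension of its coordinate ring. -/
noncomputable def varDim {K : Type} [Field K] {n : ℕ} (W : Set (Fin n → K)) : ℕ :=
  ENat.toNat ((ringKrullDim (MvPolynomial (Fin n) K ⧸ vanishingIdeal K W)).unbotD 0)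

/-- The (Zariski) tangent space of `W` at `p`:
all `y` with `∇f(p)·y = 0` for every `f ∈ I(W)`. -/
def tangentSpaceAt {K : Type} [Field K] {n : ℕ} (W : Set (Fin n → K)) (p : Fin n → K) :
    Set (Fin n → K) :=
  {y | ∀ f ∈ vanishingIdeal K W, ∑ i, eval p (pderiv i f) * y i = 0}

/-- The dimension of the tangent space at a point. -/
noncomputable def tangentDimAt {K : Type} [Field K] {n : ℕ} (W : Set (Fin n → K))
    (p : Fin n → K) : ℕ :=
  Module.finrank K (Submodule.span K (tangentSpaceAt W p))

/-- A point of an (irreducible) variety is a smooth point when the tangent space has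
the dimension of the variety. -/
def IsSmoothAt {K : Type} [Field K] {n : ℕ} (W : Set (Fin n → K)) (p : Fin n → K) : Prop :=
  tangentDimAt W p = varDim W

/-- A variety is smooth if it is smooth at each of its points. -/
def IsSmoothVariety {K : Type} [Field K] {n : ℕ} (W : Set (Fin n → K)) : Prop :=
  ∀ p ∈ W, IsSmoothAt W p

/-- Projection `A^{2n} → A^n` to the first `n` coordinates. -/
def fstProj {K : Type} {n : ℕ} (z : Fin (n + n) → K) : Fin n → K :=
  fun i => z (Fin.castAdd n i)

/-- Projection `A^{2n} → A^n` to the last `n` coordinates. -/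
def sndProj {K : Type} {n : ℕ} (z : Fin (n + n) → K) : Fin n → K :=
  fun i => z (Fin.natAdd n i)

/-- The tangent bundle `TW ⊆ A^{2n}`: pairs `(x, y)` with `x ∈ W` and `y ∈ T_x W`. -/
def tangentBundle {K : Type} [Field K] {n : ℕ} (W : Set (Fin n → K)) :
    Set (Fin (n + n) → K) :=
  {z | fstProj z ∈ W ∧ sndProj z ∈ tangentSpaceAt W (fstProj z)}

/-- Zariski closure of a subset of affine space. -/
def zclosure {K : Type} [Field K] {n : ℕ} (W : Set (Fin n → K)) : Set (Fin n → K) :=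
  zeroLocus K (vanishingIdeal K W)

/-- The tangential variety `Tan(W)`: the Zariski closure of `π₂(TW)`. -/
def tangentialVariety {K : Type} [Field K] {n : ℕ} (W : Set (Fin n → K)) :
    Set (Fin n → K) :=
  zclosure (sndProj '' tangentBundle W)

/-- The geometric degree of an (irreducible) affine algebraic set: the maximal finite
number of points in an intersection with an affine-linear subspace of complementary
dimension. -/
noncomputable def geomDegree {K : Type} [Field K] {n : ℕ} (W : Set (Fin n → K)) : ℕ :=
  sSup {m | ∃ L : AffineSubspace K (Fin n → K),
    Module.finrank K L.direction = n - varDim W ∧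
    (W ∩ (L : Set (Fin n → K))).Finite ∧ (W ∩ (L : Set (Fin n → K))).ncard = m}

/-- A linear variety: an affine-linear subspace of affine space. -/
def IsLinearVariety {K : Type} [Field K] {n : ℕ} (W : Set (Fin n → K)) : Prop :=
  ∃ L : AffineSubspace K (Fin n → K), W = (L : Set (Fin n → K))

/-- A line: an affine-linear subspace of dimension 1. -/
def IsLine {K : Type} [Field K] {n : ℕ} (W : Set (Fin n → K)) : Prop :=
  ∃ L : AffineSubspace K (Fin n → K), W = (L : Set (Fin n → K)) ∧
    Module.finrank K L.direction = 1

open Classical in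
/-- `ω(C)`: the number of points in the fiber of `π₂ : TC → Tan(C)` over a generic
point of `Tan(C)`; it is `0` when `C` is a line. -/
noncomputable def omegaCurve {K : Type} [Field K] {n : ℕ} (C : Set (Fin n → K)) : ℕ :=
  if IsLine C then 0
  else sInf {m | ∃ Z : Set (Fin n → K), IsAlgebraicSet Z ∧ ¬ tangentialVariety C ⊆ Z ∧
    ∀ v ∈ tangentialVariety C \ Z,
      {z ∈ tangentBundle C | sndProj z = v}.ncard = m}

/-- A smooth irreducible algebraic curve. -/
def IsSmoothCurve {K : Type} [Field K] {n : ℕ} (C : Set (Fin n → K)) : Prop :=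
  IsIrreducibleVariety C ∧ varDim C = 1 ∧ IsSmoothVariety C

/-! ### Heights under contraction -/

/-- If `f : R → S` is surjective up to denominators outside `Q`, contraction does not
decrease the height of `Q`. -/
theorem height_le_height_comap_of_denoms {R S : Type*} [CommRing R] [CommRing S] (f : R →+* S)
    (Q : Ideal S) [hQ : Q.IsPrime] (hf : ∀ s : S, ∃ r : R, ∃ h : S, h ∉ Q ∧ f r = h * s) :
    Q.height ≤ (Q.comap f).height := by
  have key : ∀ P₁ P₂ : PrimeSpectrum S, P₁ < P₂ → P₂.asIdeal ≤ Q →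
      PrimeSpectrum.comap f P₁ < PrimeSpectrum.comap f P₂ := by
    intro P₁ P₂ h12 hle
    refine lt_of_le_of_ne (Ideal.comap_mono h12.le) ?_
    intro heq
    apply h12.not_ge
    intro s hs
    obtain ⟨r, h, hh, hr⟩ := hf s
    have h1 : r ∈ (PrimeSpectrum.comap f P₂).asIdeal := by
      change f r ∈ P₂.asIdeal
      rw [hr]; exact Ideal.mul_mem_left _ _ hs
    rw [← heq] at h1
    have h2 : f r ∈ P₁.asIdeal := h1
    rw [hr] at h2
    rcases P₁.2.mem_or_mem h2 with h3 | h3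
    · exact absurd (hle (h12.le h3)) hh
    · exact h3
  have e1 : Q.height = Order.height (⟨Q, hQ⟩ : PrimeSpectrum S) :=
    PrimeSpectrum.height_eq_orderHeight ⟨Q, hQ⟩
  have e2 : (Q.comap f).height = Order.height (PrimeSpectrum.comap f ⟨Q, hQ⟩) :=
    PrimeSpectrum.height_eq_orderHeight (PrimeSpectrum.comap f ⟨Q, hQ⟩)
  rw [e1, e2]
  apply Order.height_le
  intro p hp
  let q : LTSeries (PrimeSpectrum R) :=
    { length := p.length
      toFun := fun i => PrimeSpectrum.comap f (p i)
      step := fun i => key _ _ (p.step i) (by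
        have : p i.succ ≤ p.last := p.monotone (Fin.le_last _)
        rw [hp] at this
        exact this) }
  have hq : q.last ≤ PrimeSpectrum.comap f ⟨Q, hQ⟩ := by
    change PrimeSpectrum.comap f p.last ≤ _
    rw [hp]
  exact Order.length_le_height (p := q) hq

/-! ### Linear algebra -/

theorem exists_coords_injective {K : Type} [Field K] {n d : ℕ} (T : Submodule K (Fin n → K))
    (hT : Module.finrank K T = d) :
    ∃ σ : Fin d → Fin n, ∀ t ∈ T, (∀ i, t (σ i) = 0) → t = 0 := by
  classical
  let v : Fin n → Module.Dual K T := fun k => (LinearMap.proj k).comp T.subtype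
  obtain ⟨κ, a, ha, hspan, hli⟩ := exists_linearIndependent' K v
  have hkill : ∀ t : T, (∀ φ ∈ Submodule.span K (Set.range v), φ t = 0) → t = 0 := by
    intro t h
    ext k
    exact h (v k) (Submodule.subset_span ⟨k, rfl⟩)
  have htop : Submodule.span K (Set.range v) = ⊤ := by
    rw [← Subspace.dualCoannihilator_dualAnnihilator_eq (W := Submodule.span K (Set.range v))]
    rw [eq_top_iff]
    intro φ _
    rw [Submodule.mem_dualAnnihilator]
    intro w hw
    rw [Submodule.mem_dualCoannihilator] at hw
    rw [hkill w hw, map_zero]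
  have : Finite κ := Finite.of_injective a ha
  have : Fintype κ := Fintype.ofFinite κ
  let b : Module.Basis κ K (Module.Dual K T) := Module.Basis.mk hli (by rw [hspan, htop])
  have hcard : Fintype.card κ = d := by
    rw [← Module.finrank_eq_card_basis b, Subspace.dual_finrank_eq, hT]
  let e : Fin d ≃ κ := (Fintype.equivFinOfCardEq hcard).symm
  refine ⟨fun i => a (e i), fun t ht h => ?_⟩
  have : (⟨t, ht⟩ : T) = 0 := by
    apply hkill
    rw [← hspan]
    intro φ hφ
    induction hφ using Submodule.span_induction with
    | mem x hx =>
      obtain ⟨k, rfl⟩ := hx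
      have := h (e.symm k)
      simpa [v] using this
    | zero => simp
    | add x y _ _ hx hy => simp [hx, hy]
    | smul c x _ hx => simp [hx]
  simpa using congrArg Subtype.val this

theorem coords_surjective {K : Type} [Field K] {n d : ℕ} (T : Submodule K (Fin n → K))
    (hT : Module.finrank K T = d) (σ : Fin d → Fin n)
    (h : ∀ t ∈ T, (∀ i, t (σ i) = 0) → t = 0) (x : Fin d → K) :
    ∃ t ∈ T, ∀ i, t (σ i) = x i := by
  let φ : T →ₗ[K] (Fin d → K) := (LinearMap.funLeft K K σ).comp T.subtype
  have hinj : Function.Injective φ := by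
    rw [← LinearMap.ker_eq_bot, LinearMap.ker_eq_bot']
    intro t ht
    exact Subtype.ext (h t t.2 fun i => congrFun ht i)
  have hsurj := (LinearMap.injective_iff_surjective_of_finrank_eq_finrank
    (f := φ) (by simp [hT])).1 hinj
  obtain ⟨t, ht⟩ := hsurj x
  exact ⟨t, t.2, fun i => congrFun ht i⟩

/-! ### Tangent spaces -/

/-- The tangent space as a submodule. -/
def tangentSub {K : Type} [Field K] {n : ℕ} (W : Set (Fin n → K)) (p : Fin n → K) :
    Submodule K (Fin n → K) where
  carrier := tangentSpaceAt W p
  zero_mem' := by intro f _; simp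
  add_mem' := by
    intro a b ha hb f hf
    have := ha f hf
    have := hb f hf
    simp_all [mul_add, Finset.sum_add_distrib]
  smul_mem' := by
    intro c a ha f hf
    have := ha f hf
    simp only [Pi.smul_apply, smul_eq_mul]
    calc _ = c * ∑ i, eval p (pderiv i f) * a i := by
          rw [Finset.mul_sum]; exact Finset.sum_congr rfl fun i _ => by ring
      _ = 0 := by rw [this, mul_zero]

theorem mem_tangentSub {K : Type} [Field K] {n : ℕ} {W : Set (Fin n → K)} {p t : Fin n → K} :
    t ∈ tangentSub W p ↔ ∀ f ∈ vanishingIdeal K W, ∑ i, eval p (pderiv i f) * t i = 0 := Iff.rfl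

theorem tangentDimAt_eq {K : Type} [Field K] {n : ℕ} (W : Set (Fin n → K)) (p : Fin n → K) :
    tangentDimAt W p = Module.finrank K (tangentSub W p) := by
  unfold tangentDimAt
  have : Submodule.span K (tangentSpaceAt W p) = tangentSub W p :=
    Submodule.span_eq (tangentSub W p)
  rw [this]

/-- The gradient of a polynomial. -/
noncomputable def gradP {K : Type} [Field K] {n : ℕ} (f : MvPolynomial (Fin n) K) :
    Fin n → MvPolynomial (Fin n) K := fun i => pderiv i f

/-- The module generated by gradients of elements of `I(V)`. -/
noncomputable def gradMod {K : Type} [Field K] {n : ℕ} (V : Set (Fin n → K)) :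
    Submodule (MvPolynomial (Fin n) K) (Fin n → MvPolynomial (Fin n) K) :=
  Submodule.span _ (gradP '' (vanishingIdeal K V : Set (MvPolynomial (Fin n) K)))

theorem gradP_mem {K : Type} [Field K] {n : ℕ} {V : Set (Fin n → K)}
    {f : MvPolynomial (Fin n) K} (hf : f ∈ vanishingIdeal K V) : gradP f ∈ gradMod V :=
  Submodule.subset_span ⟨f, hf, rfl⟩

theorem gradMod_pair {K : Type} [Field K] {n : ℕ} {V : Set (Fin n → K)}
    {u : Fin n → MvPolynomial (Fin n) K} (hu : u ∈ gradMod V) {p t : Fin n → K}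
    (ht : t ∈ tangentSub V p) : ∑ i, eval p (u i) * t i = 0 := by
  induction hu using Submodule.span_induction with
  | mem x hx => obtain ⟨f, hf, rfl⟩ := hx; exact ht f hf
  | zero => simp
  | add x y _ _ hx hy => simp [add_mul, Finset.sum_add_distrib, hx, hy]
  | smul c x _ hx => simp [mul_assoc, ← Finset.mul_sum, hx]

theorem single_mem_gradMod {K : Type} [Field K] {n : ℕ} {V : Set (Fin n → K)}
    {f : MvPolynomial (Fin n) K} (hf : f ∈ vanishingIdeal K V) (k : Fin n) :
    f • Pi.single k (1 : MvPolynomial (Fin n) K) ∈ gradMod V := by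
  have h1 : gradP (X k * f) ∈ gradMod V := gradP_mem (Ideal.mul_mem_left _ _ hf)
  have h2 : (X k : MvPolynomial (Fin n) K) • gradP f ∈ gradMod V :=
    Submodule.smul_mem _ _ (gradP_mem hf)
  convert Submodule.sub_mem _ h1 h2 using 1
  ext1 i
  simp [gradP, pderiv_X, Pi.single_apply, mul_comm, eq_comm]

theorem exists_lift_gradMod {K : Type} [Field K] {n : ℕ} {V : Set (Fin n → K)}
    {p : Fin n → K} (u₀ : Fin n → K)
    (h : ∀ t ∈ tangentSub V p, ∑ i, u₀ i * t i = 0) :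
    ∃ u ∈ gradMod V, ∀ i, eval p (u i) = u₀ i := by
  classical
  let L₀ : Submodule K (Fin n → K) :=
    Submodule.span K ((fun f i => eval p (pderiv i f)) ''
      (vanishingIdeal K V : Set (MvPolynomial (Fin n) K)))
  have hmem : u₀ ∈ L₀ := by
    by_contra hn
    obtain ⟨ψ, hψ, hψ2⟩ := Submodule.exists_dual_map_eq_bot_of_notMem hn inferInstance
    have hrep : ∀ x : Fin n → K, ψ x = ∑ i, x i * ψ (Pi.single i 1) := by
      intro x
      conv_lhs => rw [pi_eq_sum_univ' x, map_sum]
      refine Finset.sum_congr rfl fun i _ => ?_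
      rw [map_smul, smul_eq_mul]
    apply hψ
    rw [hrep]
    apply h
    intro f hf
    rw [← hrep (fun i => eval p (pderiv i f))]
    have : ψ (fun i => eval p (pderiv i f)) ∈ L₀.map ψ :=
      Submodule.mem_map_of_mem (Submodule.subset_span ⟨f, hf, rfl⟩)
    rw [hψ2] at this
    exact (Submodule.mem_bot K).1 this
  clear h
  induction hmem using Submodule.span_induction with
  | mem x hx => obtain ⟨f, hf, rfl⟩ := hx; exact ⟨gradP f, gradP_mem hf, fun i => rfl⟩
  | zero => exact ⟨0, Submodule.zero_mem _, by simp⟩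
  | add x y _ _ hx hy =>
    obtain ⟨a, ha, ha'⟩ := hx
    obtain ⟨b, hb, hb'⟩ := hy
    exact ⟨a + b, Submodule.add_mem _ ha hb, by simp [ha', hb']⟩
  | smul c x _ hx =>
    obtain ⟨a, ha, ha'⟩ := hx
    exact ⟨(C c : MvPolynomial (Fin n) K) • a, Submodule.smul_mem _ _ ha, by simp [ha']⟩

/-! ### Local and global splittings of the conormal sequence -/

/-- Near each point of `V` the cotangent module is free, with a basis taken from the `dx_k`. -/
theorem exists_local_data {K : Type} [Field K] {n : ℕ} (V : Set (Fin n → K))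
    (hprime : (vanishingIdeal K V).IsPrime) (hs : IsSmoothVariety V) {p : Fin n → K}
    (hp : p ∈ V) :
    ∃ (g : MvPolynomial (Fin n) K) (σ : Fin (varDim V) → Fin n)
      (c : Fin n → Fin (varDim V) → MvPolynomial (Fin n) K),
      eval p g ≠ 0 ∧
      (∀ k, g • Pi.single k 1 - ∑ i, c k i • Pi.single (σ i) 1 ∈ gradMod V) ∧
      (∀ f ∈ vanishingIdeal K V, ∀ i, ∑ k, pderiv k f * c k i ∈ vanishingIdeal K V) ∧
      (∀ i j, c (σ i) j - (if i = j then g else 0) ∈ vanishingIdeal K V) := by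
  classical
  have hdim : ∀ q ∈ V, Module.finrank K (tangentSub V q) = varDim V := fun q hq => by
    rw [← tangentDimAt_eq]; exact hs q hq
  obtain ⟨σ, hσ⟩ := exists_coords_injective _ (hdim p hp)
  -- linear expressions for the remaining coordinates at `p`
  have hlin : ∀ k, ∃ a : Fin (varDim V) → K, ∀ t ∈ tangentSub V p, t k = ∑ i, a i * t (σ i) := by
    choose b hbT hb using fun i : Fin (varDim V) =>
      coords_surjective _ (hdim p hp) σ hσ (Pi.single i 1)
    intro k
    refine ⟨fun i => b i k, fun t ht => ?_⟩
    have h0 : t - ∑ i, t (σ i) • b i = 0 := by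
      apply hσ
      · exact Submodule.sub_mem _ ht (Submodule.sum_mem _ fun i _ =>
          Submodule.smul_mem _ _ (hbT i))
      · intro j
        simp [Finset.sum_apply, hb, Pi.single_apply]
    have := congrFun h0 k
    simp only [Pi.sub_apply, Finset.sum_apply, Pi.smul_apply, smul_eq_mul, Pi.zero_apply,
      sub_eq_zero] at this
    rw [this]
    exact Finset.sum_congr rfl fun i _ => mul_comm _ _
  let R := MvPolynomial (Fin n) K
  let E : Submodule R (Fin n → R) :=
    gradMod V ⊔ Submodule.span R (Set.range fun i => (Pi.single (σ i) 1 : Fin n → R))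
  let m : Ideal R := vanishingIdeal K {p}
  have hnak : (⊤ : Submodule R ((Fin n → R) ⧸ E)) ≤ m • ⊤ := by
    rintro x -
    obtain ⟨x, rfl⟩ := Submodule.Quotient.mk_surjective _ x
    have hx : x = ∑ k, x k • (Pi.single k 1 : Fin n → R) := by
      ext1 j; simp [Finset.sum_apply, Pi.single_apply]
    rw [hx, ← Submodule.mkQ_apply, map_sum]
    refine Submodule.sum_mem _ fun k _ => ?_
    rw [map_smul]
    refine Submodule.smul_mem _ _ ?_
    obtain ⟨a, ha⟩ := hlin k
    obtain ⟨u, hu, hup⟩ := exists_lift_gradMod (V := V) (p := p)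
      (Pi.single k 1 - ∑ i, a i • Pi.single (σ i) 1) (by
        intro t ht
        have := ha t ht
        simp only [Pi.sub_apply, Finset.sum_apply, Pi.smul_apply, smul_eq_mul, sub_mul,
          Finset.sum_sub_distrib, Finset.sum_mul]
        rw [Finset.sum_comm]
        simp [Pi.single_apply, this])
    let w : Fin n → R := Pi.single k 1 - ∑ i, (C (a i) : R) • Pi.single (σ i) 1 - u
    have hw : ∀ j, w j ∈ m := by
      intro j
      rw [mem_vanishingIdeal_singleton_iff]
      have := hup j
      simp only [Pi.sub_apply, Finset.sum_apply, Pi.smul_apply, smul_eq_mul] at this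
      have hsing : ∀ l, eval p ((Pi.single l 1 : Fin n → R) j) = (Pi.single l 1 : Fin n → K) j := by
        intro l; simp only [Pi.single_apply]; split_ifs <;> simp
      simp only [w, Pi.sub_apply, Finset.sum_apply, Pi.smul_apply, smul_eq_mul, map_sub, map_sum,
        map_mul, aeval_eq_eval, eval_C]
      simp only [hsing]
      rw [this, sub_self]
    have hdec : (Pi.single k 1 : Fin n → R) =
        (u + ∑ i, (C (a i) : R) • Pi.single (σ i) 1) + w := by
      simp only [w]; abel
    have h1 : (u + ∑ i, (C (a i) : R) • (Pi.single (σ i) 1 : Fin n → R)) ∈ E := by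
      refine Submodule.add_mem _ (Submodule.mem_sup_left hu) (Submodule.mem_sup_right ?_)
      exact Submodule.sum_mem _ fun i _ => Submodule.smul_mem _ _ (Submodule.subset_span ⟨i, rfl⟩)
    rw [hdec, map_add, Submodule.mkQ_apply, (Submodule.Quotient.mk_eq_zero _).2 h1, zero_add]
    have hw2 : w = ∑ k, w k • (Pi.single k 1 : Fin n → R) := by
      ext1 j; simp [Finset.sum_apply, Pi.single_apply]
    rw [hw2, map_sum]
    refine Submodule.sum_mem _ fun l _ => ?_
    rw [map_smul]
    exact Submodule.smul_mem_smul (hw l) trivial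
  obtain ⟨g, hg1, hg⟩ := Submodule.exists_sub_one_mem_and_smul_eq_zero_of_fg_of_le_smul m ⊤
    (Module.Finite.fg_top) hnak
  have hgp : eval p g = 1 := by
    have := (mem_vanishingIdeal_singleton_iff _ _).1 hg1
    rw [aeval_eq_eval] at this
    simpa [sub_eq_zero] using this
  have hgE : ∀ k, g • (Pi.single k 1 : Fin n → R) ∈ E := by
    intro k
    rw [← Submodule.Quotient.mk_eq_zero, Submodule.Quotient.mk_smul]
    exact hg _ trivial
  have hc : ∀ k, ∃ c : Fin (varDim V) → R,
      g • (Pi.single k 1 : Fin n → R) - ∑ i, c i • Pi.single (σ i) 1 ∈ gradMod V := by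
    intro k
    obtain ⟨y, hy, z, hz, hyz⟩ := Submodule.mem_sup.1 (hgE k)
    obtain ⟨c, hc⟩ := (Submodule.mem_span_range_iff_exists_fun R).1 hz
    refine ⟨c, ?_⟩
    rw [hc, ← hyz, add_sub_cancel_right]
    exact hy
  choose c hc using hc
  have hgI : g ∉ vanishingIdeal K V := by
    intro h
    have := h p hp
    rw [aeval_eq_eval] at this
    simp [hgp] at this
  -- independence
  have hind : ∀ h : Fin (varDim V) → R,
      (∑ i, h i • (Pi.single (σ i) 1 : Fin n → R)) ∈ gradMod V →
      ∀ i, h i ∈ vanishingIdeal K V := by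
    intro h hh i
    refine (hprime.mem_or_mem (x := g) (y := h i) ?_).resolve_left hgI
    intro q hq
    rw [aeval_eq_eval]
    simp only [map_mul]
    by_cases hgq : eval q g = 0
    · simp [hgq]
    have hpair : ∀ (h : Fin (varDim V) → R) (t : Fin n → K),
        ∑ j, eval q ((∑ i, h i • (Pi.single (σ i) 1 : Fin n → R)) j) * t j =
          ∑ i, eval q (h i) * t (σ i) := by
      intro h t
      simp only [Finset.sum_apply, Pi.smul_apply, smul_eq_mul, map_sum, map_mul, Finset.sum_mul]
      rw [Finset.sum_comm]
      refine Finset.sum_congr rfl fun i _ => ?_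
      rw [Finset.sum_eq_single (σ i)]
      · simp
      · intro b _ hb; simp [hb]
      · simp
    have hinj : ∀ t ∈ tangentSub V q, (∀ i, t (σ i) = 0) → t = 0 := by
      intro t ht h0
      ext k
      have h1 := gradMod_pair (hc k) ht
      simp only [Pi.sub_apply, map_sub, sub_mul, Finset.sum_sub_distrib, hpair, h0, mul_zero,
        Finset.sum_const_zero, sub_zero] at h1
      rw [Finset.sum_eq_single k] at h1
      · simpa [hgq] using h1
      · intro b _ hb; simp [hb]
      · simp
    obtain ⟨t, ht, hti⟩ := coords_surjective _ (hdim q hq) σ hinj (Pi.single i 1)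
    have h1 := gradMod_pair hh ht
    rw [hpair] at h1
    simp only [hti, Pi.single_apply, mul_ite, mul_one, mul_zero, Finset.sum_ite_eq',
      Finset.mem_univ, if_true] at h1
    rw [h1, mul_zero]
  refine ⟨g, σ, c, by rw [hgp]; exact one_ne_zero, hc, ?_, ?_⟩
  · intro f hf
    apply hind
    have h1 : ∑ k, pderiv k f • (g • (Pi.single k 1 : Fin n → R) - ∑ i, c k i • Pi.single (σ i) 1)
        ∈ gradMod V := Submodule.sum_mem _ fun k _ => Submodule.smul_mem _ _ (hc k)
    have h2 : g • gradP f ∈ gradMod V := Submodule.smul_mem _ _ (gradP_mem hf)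
    convert Submodule.sub_mem _ h2 h1 using 1
    have h3 : gradP f = ∑ k, pderiv k f • (Pi.single k 1 : Fin n → R) := by
      ext1 j; simp [Finset.sum_apply, Pi.single_apply, gradP]
    rw [h3]
    simp only [smul_sub, Finset.sum_sub_distrib, Finset.smul_sum, smul_smul]
    rw [Finset.sum_comm]
    simp only [mul_comm g, sub_sub_cancel]
    exact Finset.sum_congr rfl fun i _ => Finset.sum_smul
  · intro i
    have h1 := hind (fun j => (c (σ i) j - (if i = j then g else 0))) (by
      convert Submodule.neg_mem _ (hc (σ i)) using 1
      simp [sub_smul, Finset.sum_sub_distrib, ite_smul])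
    exact h1

theorem mem_of_vanishing_le {K : Type} [Field K] {n : ℕ} {V : Set (Fin n → K)}
    (hV : IsAlgebraicSet V) {p : Fin n → K} (h : vanishingIdeal K V ≤ vanishingIdeal K {p}) :
    p ∈ V := by
  obtain ⟨I, rfl⟩ := hV
  intro f hf
  exact h (le_vanishingIdeal_zeroLocus I hf) p rfl

/-- A global splitting of `A^n → Ω_A`, lifted to polynomials. -/
theorem exists_splitting {K : Type} [Field K] [IsAlgClosed K] {n : ℕ} (V : Set (Fin n → K))
    (hV : IsAlgebraicSet V)
    (hprime : (vanishingIdeal K V).IsPrime) (hs : IsSmoothVariety V) :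
    ∃ S : Fin n → Fin n → MvPolynomial (Fin n) K,
      (∀ f ∈ vanishingIdeal K V, ∀ i, ∑ k, pderiv k f * S k i ∈ vanishingIdeal K V) ∧
      (∀ k, Pi.single k 1 - S k ∈ gradMod V) := by
  classical
  let R := MvPolynomial (Fin n) K
  let D : Ideal R :=
    { carrier := {a | ∃ S : Fin n → Fin n → R,
        (∀ f ∈ vanishingIdeal K V, ∀ i, ∑ k, pderiv k f * S k i ∈ vanishingIdeal K V) ∧
        (∀ k, a • Pi.single k 1 - S k ∈ gradMod V)}
      zero_mem' := ⟨0, by simp, by simp⟩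
      add_mem' := by
        rintro a b ⟨S, hS, hS'⟩ ⟨T, hT, hT'⟩
        refine ⟨S + T, fun f hf i => ?_, fun k => ?_⟩
        · simp only [Pi.add_apply, mul_add, Finset.sum_add_distrib]
          exact Ideal.add_mem _ (hS f hf i) (hT f hf i)
        · convert Submodule.add_mem _ (hS' k) (hT' k) using 1
          rw [add_smul, Pi.add_apply]; abel
      smul_mem' := by
        rintro a b ⟨S, hS, hS'⟩
        refine ⟨fun k => a • S k, fun f hf i => ?_, fun k => ?_⟩
        · convert Ideal.mul_mem_left _ a (hS f hf i) using 1
          rw [Finset.mul_sum]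
          exact Finset.sum_congr rfl fun k _ => by simp; ring
        · convert Submodule.smul_mem _ a (hS' k) using 1
          rw [smul_sub, smul_smul, smul_eq_mul] }
  suffices h : (1 : R) ∈ D by
    obtain ⟨S, hS, hS'⟩ := h
    exact ⟨S, hS, fun k => by simpa using hS' k⟩
  rw [← Ideal.eq_top_iff_one]
  by_contra hne
  obtain ⟨M, hM, hDM⟩ := Ideal.exists_le_maximal D hne
  obtain ⟨p, rfl⟩ := isMaximal_iff_eq_vanishingIdeal_singleton.1 hM
  have hp : p ∈ V := by
    apply mem_of_vanishing_le hV
    refine le_trans ?_ hDM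
    intro a ha
    exact ⟨0, by simp, fun k => by simpa using single_mem_gradMod ha k⟩
  obtain ⟨g, σ, c, hgp, hc, hc2, -⟩ := exists_local_data V hprime hs hp
  have : g ∈ D := by
    refine ⟨fun k => ∑ i, c k i • Pi.single (σ i) 1, fun f hf i => ?_, hc⟩
    have : ∑ k, pderiv k f * (∑ j, c k j • (Pi.single (σ j) 1 : Fin n → R)) i =
        ∑ j, (∑ k, pderiv k f * c k j) * (Pi.single (σ j) 1 : Fin n → R) i := by
      simp only [Finset.sum_apply, Pi.smul_apply, smul_eq_mul, Finset.mul_sum, Finset.sum_mul]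
      rw [Finset.sum_comm]
      simp only [mul_assoc]
    rw [this]
    exact Ideal.sum_mem _ fun j _ => Ideal.mul_mem_right _ _ (hc2 f hf j)
  have h2 := hDM this p rfl
  rw [aeval_eq_eval] at h2
  exact hgp (by simpa using h2)

/-! ### The ideal of the tangent bundle -/

/-- The linear form `u · y`. -/
noncomputable def linForm {K : Type} [Field K] {n : ℕ} (u : Fin n → MvPolynomial (Fin n) K) :
    MvPolynomial (Fin (n + n)) K :=
  ∑ i : Fin n, rename (Fin.castAdd n) (u i) * X (Fin.natAdd n i)

/-- The ideal generated by the `f_j` and the `∇ f_j · y`. -/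
noncomputable def tanIdeal {K : Type} [Field K] {n r : ℕ} (f : Fin r → MvPolynomial (Fin n) K) :
    Ideal (MvPolynomial (Fin (n + n)) K) :=
  Ideal.span ((Set.range fun j => rename (Fin.castAdd n) (f j)) ∪
          (Set.range fun j => ∑ i : Fin n,
            rename (Fin.castAdd n) (pderiv i (f j)) * X (Fin.natAdd n i)))

theorem linForm_add {K : Type} [Field K] {n : ℕ} (u v : Fin n → MvPolynomial (Fin n) K) :
    linForm (u + v) = linForm u + linForm v := by
  simp [linForm, add_mul, Finset.sum_add_distrib]

theorem linForm_smul {K : Type} [Field K] {n : ℕ} (a : MvPolynomial (Fin n) K)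
    (u : Fin n → MvPolynomial (Fin n) K) :
    linForm (a • u) = rename (Fin.castAdd n) a * linForm u := by
  simp [linForm, mul_assoc, Finset.mul_sum]

theorem linForm_sub {K : Type} [Field K] {n : ℕ} (u v : Fin n → MvPolynomial (Fin n) K) :
    linForm (u - v) = linForm u - linForm v := by
  simp [linForm, sub_mul, Finset.sum_sub_distrib]

theorem linForm_single {K : Type} [Field K] {n : ℕ} (k : Fin n) :
    linForm (Pi.single k (1 : MvPolynomial (Fin n) K)) = X (Fin.natAdd n k) := by
  classical
  unfold linForm
  rw [Finset.sum_eq_single k]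
  · simp
  · intro b _ hb; simp [hb]
  · simp

section Gens

variable {K : Type} [Field K] {n r : ℕ} {V : Set (Fin n → K)}
  {f : Fin r → MvPolynomial (Fin n) K}

theorem rename_mem_tanIdeal (hgen : vanishingIdeal K V = Ideal.span (Set.range f))
    {a : MvPolynomial (Fin n) K} (ha : a ∈ vanishingIdeal K V) :
    rename (Fin.castAdd n) a ∈ tanIdeal f := by
  rw [hgen] at ha
  have : Ideal.span (Set.range f) ≤
      (tanIdeal f).comap (rename (R := K) (Fin.castAdd n)) := by
    rw [Ideal.span_le]
    rintro _ ⟨j, rfl⟩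
    exact Ideal.subset_span (Or.inl ⟨j, rfl⟩)
  exact this ha

theorem linForm_grad_mem_tanIdeal (hgen : vanishingIdeal K V = Ideal.span (Set.range f))
    {a : MvPolynomial (Fin n) K} (ha : a ∈ vanishingIdeal K V) :
    linForm (gradP a) ∈ tanIdeal f := by
  rw [hgen] at ha
  induction ha using Submodule.span_induction with
  | mem x hx =>
    obtain ⟨j, rfl⟩ := hx
    exact Ideal.subset_span (Or.inr ⟨j, rfl⟩)
  | zero =>
    have : gradP (0 : MvPolynomial (Fin n) K) = 0 := by ext1 i; simp [gradP]
    rw [this]; simp [linForm]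
  | add x y _ _ hx hy =>
    have : gradP (x + y) = gradP x + gradP y := by ext1 i; simp [gradP]
    rw [this, linForm_add]; exact Ideal.add_mem _ hx hy
  | smul c x hx' hx =>
    have : gradP (c • x) = c • gradP x + x • gradP c := by
      ext1 i; simp [gradP]
    rw [this, linForm_add, linForm_smul, linForm_smul]
    exact Ideal.add_mem _ (Ideal.mul_mem_left _ _ hx)
      (Ideal.mul_mem_right _ _ (rename_mem_tanIdeal hgen (by rw [hgen]; exact hx')))

theorem linForm_mem_tanIdeal (hgen : vanishingIdeal K V = Ideal.span (Set.range f))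
    {u : Fin n → MvPolynomial (Fin n) K} (hu : u ∈ gradMod V) : linForm u ∈ tanIdeal f := by
  induction hu using Submodule.span_induction with
  | mem x hx => obtain ⟨a, ha, rfl⟩ := hx; exact linForm_grad_mem_tanIdeal hgen ha
  | zero => simp [linForm]
  | add x y _ _ hx hy => rw [linForm_add]; exact Ideal.add_mem _ hx hy
  | smul c x _ hx => rw [linForm_smul]; exact Ideal.mul_mem_left _ _ hx

/-- The map `K[x,y] → A[t]`, `y_k ↦ ∑ c_{ki} t_i`. -/
noncomputable def phiMap (V : Set (Fin n → K)) {m : ℕ}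
    (c : Fin n → Fin m → MvPolynomial (Fin n) K) :
    MvPolynomial (Fin (n + n)) K →ₐ[K]
      MvPolynomial (Fin m) (MvPolynomial (Fin n) K ⧸ vanishingIdeal K V) :=
  aeval (Fin.addCases (fun i => C (Ideal.Quotient.mk _ (X i)))
    (fun k => ∑ i, C (Ideal.Quotient.mk _ (c k i)) * X i))

theorem phiMap_natAdd {m : ℕ} (c : Fin n → Fin m → MvPolynomial (Fin n) K) (k : Fin n) :
    phiMap V c (X (Fin.natAdd n k)) =
      ∑ i, C (Ideal.Quotient.mk (vanishingIdeal K V) (c k i)) * X i := by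
  rw [phiMap, aeval_X, Fin.addCases_right]

theorem phiMap_rename {m : ℕ} (c : Fin n → Fin m → MvPolynomial (Fin n) K)
    (a : MvPolynomial (Fin n) K) :
    phiMap V c (rename (Fin.castAdd n) a) = C (Ideal.Quotient.mk (vanishingIdeal K V) a) := by
  have : (phiMap V c).comp (rename (Fin.castAdd n)) =
      ((IsScalarTower.toAlgHom K (MvPolynomial (Fin n) K ⧸ vanishingIdeal K V)
        (MvPolynomial (Fin m) (MvPolynomial (Fin n) K ⧸ vanishingIdeal K V))).comp
        (Ideal.Quotient.mkₐ K (vanishingIdeal K V))) := by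
    apply MvPolynomial.algHom_ext
    intro i
    simp [phiMap, MvPolynomial.algebraMap_eq]
  exact DFunLike.congr_fun this a

theorem phiMap_eq_zero (hgen : vanishingIdeal K V = Ideal.span (Set.range f)) {m : ℕ}
    (c : Fin n → Fin m → MvPolynomial (Fin n) K)
    (hc : ∀ a ∈ vanishingIdeal K V, ∀ i, ∑ k, pderiv k a * c k i ∈ vanishingIdeal K V)
    {F : MvPolynomial (Fin (n + n)) K} (hF : F ∈ tanIdeal f) : phiMap V c F = 0 := by
  have hfI : ∀ j, f j ∈ vanishingIdeal K V := fun j => by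
    rw [hgen]; exact Ideal.subset_span ⟨j, rfl⟩
  have : tanIdeal f ≤ RingHom.ker (phiMap V c) := by
    unfold tanIdeal
    rw [Ideal.span_le]
    rintro _ (⟨j, rfl⟩ | ⟨j, rfl⟩)
    · change phiMap V c _ = 0
      rw [phiMap_rename, Ideal.Quotient.eq_zero_iff_mem.2 (hfI j), map_zero]
    · change phiMap V c _ = 0
      simp only [map_sum, map_mul, phiMap_rename, phiMap_natAdd, Finset.mul_sum]
      rw [Finset.sum_comm]
      refine Finset.sum_eq_zero fun i _ => ?_
      have h := Ideal.Quotient.eq_zero_iff_mem.2 (hc (f j) (hfI j) i)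
      have h' := congrArg (C (σ := Fin m)) h
      simp only [map_sum, map_mul, map_zero] at h'
      simp only [← mul_assoc]
      rw [← Finset.sum_mul, h', zero_mul]
  exact this hF

/-- The map `A[t] → K[x,y]/J`, `t_i ↦ y_{σ i}`. -/
noncomputable def psiMap (hgen : vanishingIdeal K V = Ideal.span (Set.range f)) {m : ℕ}
    (σ : Fin m → Fin n) :
    MvPolynomial (Fin m) (MvPolynomial (Fin n) K ⧸ vanishingIdeal K V) →+*
      MvPolynomial (Fin (n + n)) K ⧸ tanIdeal f :=
  eval₂Hom (Ideal.Quotient.lift (vanishingIdeal K V)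
    ((Ideal.Quotient.mk (tanIdeal f)).comp (rename (R := K) (Fin.castAdd n)).toRingHom)
    (fun _ ha => Ideal.Quotient.eq_zero_iff_mem.2 (rename_mem_tanIdeal hgen ha)))
    (fun i => Ideal.Quotient.mk _ (X (Fin.natAdd n (σ i))))

theorem psiMap_C (hgen : vanishingIdeal K V = Ideal.span (Set.range f)) {m : ℕ}
    (σ : Fin m → Fin n) (a : MvPolynomial (Fin n) K) :
    psiMap hgen σ (C (Ideal.Quotient.mk _ a)) =
      Ideal.Quotient.mk _ (rename (Fin.castAdd n) a) := by
  simp [psiMap]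

theorem psiMap_X (hgen : vanishingIdeal K V = Ideal.span (Set.range f)) {m : ℕ}
    (σ : Fin m → Fin n) (i : Fin m) :
    psiMap hgen σ (X i) = Ideal.Quotient.mk _ (X (Fin.natAdd n (σ i))) := by
  simp [psiMap]

theorem tanIdeal_prime (hgen : vanishingIdeal K V = Ideal.span (Set.range f))
    (hprime : (vanishingIdeal K V).IsPrime)
    (S : Fin n → Fin n → MvPolynomial (Fin n) K)
    (hS : ∀ a ∈ vanishingIdeal K V, ∀ i, ∑ k, pderiv k a * S k i ∈ vanishingIdeal K V)
    (hS' : ∀ k, Pi.single k 1 - S k ∈ gradMod V) : (tanIdeal f).IsPrime := by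
  have hcomp : ((psiMap hgen id).comp (phiMap V S).toRingHom) = Ideal.Quotient.mk (tanIdeal f) := by
    apply MvPolynomial.ringHom_ext
    · intro a
      have h := phiMap_rename (V := V) S (C a)
      rw [rename_C] at h
      change psiMap hgen id (phiMap V S (C a)) = _
      rw [h, psiMap_C, rename_C]
    · intro i
      change psiMap hgen id (phiMap V S (X i)) = _
      refine Fin.addCases (fun i => ?_) (fun k => ?_) i
      · have h := phiMap_rename (V := V) S (X i)
        rw [rename_X] at h
        rw [h, psiMap_C, rename_X]
      · rw [phiMap_natAdd]
        simp only [map_sum, map_mul, psiMap_C, psiMap_X, id]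
        simp only [← map_mul, ← map_sum]
        symm
        rw [Ideal.Quotient.eq]
        have := linForm_mem_tanIdeal hgen (hS' k)
        rw [linForm_sub, linForm_single] at this
        exact this
  have hker : tanIdeal f = RingHom.ker (phiMap V S) := by
    apply le_antisymm
    · intro F hF
      exact phiMap_eq_zero hgen S hS hF
    · intro F hF
      have h0 : phiMap V S F = 0 := hF
      have h1 := DFunLike.congr_fun hcomp F
      rw [← Ideal.Quotient.eq_zero_iff_mem, ← h1]
      change psiMap hgen id (phiMap V S F) = 0
      rw [h0, map_zero]
  rw [hker]
  exact RingHom.ker_isPrime _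

theorem tangentBundle_eq_zeroLocus (hV : IsAlgebraicSet V)
    (hgen : vanishingIdeal K V = Ideal.span (Set.range f)) :
    tangentBundle V = zeroLocus K (tanIdeal f) := by
  have hren : ∀ (z : Fin (n + n) → K) (a : MvPolynomial (Fin n) K),
      eval z (rename (Fin.castAdd n) a) = eval (fstProj z) a := by
    intro z a; rw [eval_rename]; rfl
  have hlin : ∀ (z : Fin (n + n) → K) (a : MvPolynomial (Fin n) K),
      eval z (linForm (gradP a)) = ∑ i, eval (fstProj z) (pderiv i a) * sndProj z i := by
    intro z a; simp [linForm, gradP, hren, sndProj]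
  have hfI : ∀ j, f j ∈ vanishingIdeal K V := fun j => by
    rw [hgen]; exact Ideal.subset_span ⟨j, rfl⟩
  ext z
  constructor
  · rintro ⟨h1, h2⟩
    rw [tanIdeal, zeroLocus_span]
    rintro _ (⟨j, rfl⟩ | ⟨j, rfl⟩)
    · simp only [aeval_eq_eval]
      rw [hren]
      have := hfI j _ h1
      rwa [aeval_eq_eval] at this
    · simp only [aeval_eq_eval]
      exact (hlin z (f j)).trans (h2 _ (hfI j))
  · intro h
    refine ⟨?_, ?_⟩
    · apply mem_of_vanishing_le hV
      intro a ha
      rw [mem_vanishingIdeal_singleton_iff, aeval_eq_eval, ← hren]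
      have := h _ (rename_mem_tanIdeal hgen ha)
      rwa [aeval_eq_eval] at this
    · intro a ha
      have := h _ (linForm_grad_mem_tanIdeal hgen ha)
      rw [aeval_eq_eval] at this
      exact (hlin z a).symm.trans this

end Gens

/-! ### Dimension -/

section Dim

variable {K : Type} [Field K] {n r : ℕ} {V : Set (Fin n → K)}
  {f : Fin r → MvPolynomial (Fin n) K}

theorem exists_point_of_proper [IsAlgClosed K] (hV : IsAlgebraicSet V)
    {q : Ideal (MvPolynomial (Fin n) K)} (hq : q ≠ ⊤) (hVq : vanishingIdeal K V ≤ q) :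
    ∃ p ∈ V, ∀ g ∈ q, eval p g = 0 := by
  obtain ⟨M, hM, hqM⟩ := Ideal.exists_le_maximal q hq
  obtain ⟨p, rfl⟩ := isMaximal_iff_eq_vanishingIdeal_singleton.1 hM
  refine ⟨p, mem_of_vanishing_le hV (hVq.trans hqM), fun g hg => ?_⟩
  have := hqM hg p rfl
  rwa [aeval_eq_eval] at this

theorem dim_le_one [IsAlgClosed K] (hV : IsAlgebraicSet V)
    (hgen : vanishingIdeal K V = Ideal.span (Set.range f))
    (hprime : (vanishingIdeal K V).IsPrime) (hs : IsSmoothVariety V) :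
    ringKrullDim (MvPolynomial (Fin (n + n)) K ⧸ tanIdeal f) ≤
      ringKrullDim (MvPolynomial (Fin (varDim V))
        (MvPolynomial (Fin n) K ⧸ vanishingIdeal K V)) := by
  refine (ringKrullDim_le_iff_height_le _).2 ?_
  intro Q hQ
  let ι' : MvPolynomial (Fin n) K →+* MvPolynomial (Fin (n + n)) K ⧸ tanIdeal f :=
    (Ideal.Quotient.mk (tanIdeal f)).comp (rename (R := K) (Fin.castAdd n)).toRingHom
  have hq : (Q.comap ι').IsPrime := Ideal.comap_isPrime _ _
  obtain ⟨p, hp, hpq⟩ := exists_point_of_proper (q := Q.comap ι') hV hq.ne_top (by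
    intro a ha
    have : ι' a = 0 := Ideal.Quotient.eq_zero_iff_mem.2 (rename_mem_tanIdeal hgen ha)
    rw [Ideal.mem_comap, this]
    exact Q.zero_mem)
  obtain ⟨g, σ, c, hgp, hc, hc2, hc3⟩ := exists_local_data V hprime hs hp
  have hgQ : ι' g ∉ Q := fun h => hgp (hpq g h)
  have hψC : ∀ a, psiMap hgen σ (C (Ideal.Quotient.mk _ a)) = ι' a := fun a => psiMap_C hgen σ a
  have hden : ∀ F : MvPolynomial (Fin (n + n)) K, ∃ x, ∃ N : ℕ,
      psiMap hgen σ x = ι' g ^ N * Ideal.Quotient.mk (tanIdeal f) F := by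
    intro F
    induction F using MvPolynomial.induction_on with
    | C a =>
      refine ⟨C (Ideal.Quotient.mk _ (C a)), 0, ?_⟩
      rw [psiMap_C, rename_C, pow_zero, one_mul]
    | add F G hF hG =>
      obtain ⟨x, N, hx⟩ := hF
      obtain ⟨y, M, hy⟩ := hG
      refine ⟨C (Ideal.Quotient.mk _ g) ^ M * x + C (Ideal.Quotient.mk _ g) ^ N * y, N + M, ?_⟩
      simp only [map_add, map_mul, map_pow, hψC, hx, hy]
      ring
    | mul_X F i hF =>
      obtain ⟨x, N, hx⟩ := hF
      refine Fin.addCases (fun i => ?_) (fun k => ?_) i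
      · refine ⟨x * C (Ideal.Quotient.mk _ (X i)), N, ?_⟩
        rw [map_mul, hx, psiMap_C, rename_X, map_mul, mul_assoc]
      · refine ⟨x * ∑ i, C (Ideal.Quotient.mk _ (c k i)) * X i, N + 1, ?_⟩
        have h1 := linForm_mem_tanIdeal hgen (hc k)
        have hsum : linForm (∑ i, c k i • Pi.single (σ i) (1 : MvPolynomial (Fin n) K)) =
            ∑ i, rename (Fin.castAdd n) (c k i) * X (Fin.natAdd n (σ i)) := by
          simp only [← linForm_single, ← linForm_smul]
          simp only [linForm, Finset.sum_apply, map_sum, Finset.sum_mul]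
          rw [Finset.sum_comm]
        rw [linForm_sub, linForm_smul, linForm_single, hsum, ← Ideal.Quotient.eq] at h1
        have h2 : psiMap hgen σ (∑ i, C (Ideal.Quotient.mk _ (c k i)) * X i) =
            ι' g * Ideal.Quotient.mk _ (X (Fin.natAdd n k)) := by
          simp only [map_sum, map_mul, psiMap_C, psiMap_X]
          simp only [map_mul, map_sum] at h1
          exact h1.symm
        rw [map_mul, hx, h2, map_mul]
        ring
  have hden2 : ∀ b, ∃ x, ∃ h, h ∉ Q ∧ psiMap hgen σ x = h * b := by
    intro b
    obtain ⟨F, rfl⟩ := Ideal.Quotient.mk_surjective b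
    obtain ⟨x, N, hx⟩ := hden F
    exact ⟨x, ι' g ^ N, fun h => hgQ (hQ.mem_of_pow_mem _ h), hx⟩
  have := height_le_height_comap_of_denoms
    (R := MvPolynomial (Fin (varDim V)) (MvPolynomial (Fin n) K ⧸ vanishingIdeal K V))
    (S := MvPolynomial (Fin (n + n)) K ⧸ tanIdeal f) (psiMap hgen σ) Q hden2
  refine le_trans (WithBot.coe_le_coe.2 this) ?_
  have : (Q.comap (psiMap hgen σ)).IsPrime := Ideal.comap_isPrime _ _
  exact Ideal.height_le_ringKrullDim_of_isPrime

theorem dim_le_two [IsAlgClosed K] (hV : IsAlgebraicSet V)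
    (hgen : vanishingIdeal K V = Ideal.span (Set.range f))
    (hprime : (vanishingIdeal K V).IsPrime) (hs : IsSmoothVariety V) :
    ringKrullDim (MvPolynomial (Fin (varDim V))
        (MvPolynomial (Fin n) K ⧸ vanishingIdeal K V)) ≤
      ringKrullDim (MvPolynomial (Fin (n + n)) K ⧸ tanIdeal f) := by
  refine (ringKrullDim_le_iff_height_le
    (R := MvPolynomial (Fin (varDim V)) (MvPolynomial (Fin n) K ⧸ vanishingIdeal K V)) _).2 ?_
  intro Q hQ
  let ι' : MvPolynomial (Fin n) K →+* MvPolynomial (Fin (varDim V))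
        (MvPolynomial (Fin n) K ⧸ vanishingIdeal K V) := C.comp (Ideal.Quotient.mk _)
  have hq : (Q.comap ι').IsPrime := Ideal.comap_isPrime _ _
  obtain ⟨p, hp, hpq⟩ := exists_point_of_proper (q := Q.comap ι') hV hq.ne_top (by
    intro a ha
    have : ι' a = 0 := by
      change C (Ideal.Quotient.mk _ a) = 0
      rw [Ideal.Quotient.eq_zero_iff_mem.2 ha, map_zero]
    rw [Ideal.mem_comap, this]
    exact Q.zero_mem)
  obtain ⟨g, σ, c, hgp, hc, hc2, hc3⟩ := exists_local_data V hprime hs hp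
  have hgQ : ι' g ∉ Q := fun h => hgp (hpq g h)
  let φ : MvPolynomial (Fin (n + n)) K ⧸ tanIdeal f →+* MvPolynomial (Fin (varDim V))
        (MvPolynomial (Fin n) K ⧸ vanishingIdeal K V) :=
    Ideal.Quotient.lift (tanIdeal f) (phiMap V c).toRingHom
      (fun F hF => phiMap_eq_zero hgen c hc2 hF)
  have hφ : ∀ F, φ (Ideal.Quotient.mk _ F) = phiMap V c F := fun F => rfl
  have hX : ∀ i, phiMap V c (X (Fin.natAdd n (σ i))) = ι' g * X i := by
    intro i
    rw [phiMap_natAdd]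
    have h : ∀ j, Ideal.Quotient.mk (vanishingIdeal K V) (c (σ i) j) =
        Ideal.Quotient.mk (vanishingIdeal K V) (if i = j then g else 0) := fun j =>
      Ideal.Quotient.eq.2 (hc3 i j)
    simp only [h]
    rw [Finset.sum_eq_single i]
    · simp [ι']
    · intro b _ hb; simp [hb.symm]
    · simp
  have hden : ∀ x : MvPolynomial (Fin (varDim V)) (MvPolynomial (Fin n) K ⧸ vanishingIdeal K V),
      ∃ F, ∃ N : ℕ, phiMap V c F = ι' g ^ N * x := by
    intro x
    induction x using MvPolynomial.induction_on with
    | C a =>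
      obtain ⟨a, rfl⟩ := Ideal.Quotient.mk_surjective a
      exact ⟨rename (Fin.castAdd n) a, 0, by rw [phiMap_rename, pow_zero, one_mul]⟩
    | add x y hx hy =>
      obtain ⟨F, N, hF⟩ := hx
      obtain ⟨G, M, hG⟩ := hy
      refine ⟨rename (Fin.castAdd n) g ^ M * F + rename (Fin.castAdd n) g ^ N * G, N + M, ?_⟩
      have hg : phiMap V c (rename (Fin.castAdd n) g) = ι' g := phiMap_rename c g
      rw [map_add, map_mul, map_mul, map_pow, map_pow, hg, hF, hG]
      ring
    | mul_X x i hx =>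
      obtain ⟨F, N, hF⟩ := hx
      refine ⟨F * X (Fin.natAdd n (σ i)), N + 1, ?_⟩
      rw [map_mul, hX, hF]
      ring
  have hden2 : ∀ x, ∃ b, ∃ h, h ∉ Q ∧ φ b = h * x := by
    intro x
    obtain ⟨F, N, hx⟩ := hden x
    exact ⟨Ideal.Quotient.mk _ F, ι' g ^ N, fun h => hgQ (hQ.mem_of_pow_mem _ h), hx⟩
  have := height_le_height_comap_of_denoms
    (S := MvPolynomial (Fin (varDim V)) (MvPolynomial (Fin n) K ⧸ vanishingIdeal K V))
    (R := MvPolynomial (Fin (n + n)) K ⧸ tanIdeal f) φ Q hden2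
  refine le_trans (WithBot.coe_le_coe.2 this) ?_
  have : (Q.comap φ).IsPrime := Ideal.comap_isPrime _ _
  exact Ideal.height_le_ringKrullDim_of_isPrime

theorem varDim_coe (hprime : (vanishingIdeal K V).IsPrime) :
    ringKrullDim (MvPolynomial (Fin n) K ⧸ vanishingIdeal K V) = (varDim V : ℕ) := by
  have hle : ringKrullDim (MvPolynomial (Fin n) K ⧸ vanishingIdeal K V) ≤ (n : ℕ) := by
    refine (ringKrullDim_quotient_le _).trans ?_
    simp
  have hnt : Nontrivial (MvPolynomial (Fin n) K ⧸ vanishingIdeal K V) :=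
    Ideal.Quotient.nontrivial_iff.2 hprime.ne_top
  have hge := ringKrullDim_nonneg_of_nontrivial
    (R := MvPolynomial (Fin n) K ⧸ vanishingIdeal K V)
  unfold varDim
  generalize ringKrullDim (MvPolynomial (Fin n) K ⧸ vanishingIdeal K V) = x at hle hge
  induction x with
  | bot => simp at hge
  | coe x =>
    induction x with
    | top =>
      exfalso
      have := WithBot.coe_le_coe.1 hle
      simp at this
    | coe x => rfl

theorem varDim_tangentBundle [IsAlgClosed K] (hV : IsAlgebraicSet V)
    (hgen : vanishingIdeal K V = Ideal.span (Set.range f))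
    (hprime : (vanishingIdeal K V).IsPrime) (hs : IsSmoothVariety V)
    (hI : vanishingIdeal K (tangentBundle V) = tanIdeal f) :
    varDim (tangentBundle V) = 2 * varDim V := by
  have h : ringKrullDim (MvPolynomial (Fin (n + n)) K ⧸ vanishingIdeal K (tangentBundle V)) =
      ((2 * varDim V : ℕ) : WithBot ℕ∞) := by
    rw [hI, le_antisymm (dim_le_one hV hgen hprime hs) (dim_le_two hV hgen hprime hs),
      MvPolynomial.ringKrullDim_of_isNoetherianRing, varDim_coe hprime, Nat.card_fin, two_mul]
    push_cast
    rfl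
  rw [varDim, h]
  rfl

end Dim

/-! ### Smoothness -/

section Smooth

variable {K : Type} [Field K] {n r : ℕ} {V : Set (Fin n → K)}
  {f : Fin r → MvPolynomial (Fin n) K}

/-- The derivative at `z` in direction `t`. -/
noncomputable def dirDer {m : ℕ} (z t : Fin m → K) (F : MvPolynomial (Fin m) K) : K :=
  ∑ i, eval z (pderiv i F) * t i

theorem dirDer_add {m : ℕ} (z t : Fin m → K) (F G : MvPolynomial (Fin m) K) :
    dirDer z t (F + G) = dirDer z t F + dirDer z t G := by
  simp [dirDer, add_mul, Finset.sum_add_distrib]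

theorem dirDer_zero {m : ℕ} (z t : Fin m → K) : dirDer z t 0 = 0 := by
  simp [dirDer]

theorem dirDer_sum {m : ℕ} {ι : Type} (s : Finset ι) (z t : Fin m → K)
    (F : ι → MvPolynomial (Fin m) K) :
    dirDer z t (∑ i ∈ s, F i) = ∑ i ∈ s, dirDer z t (F i) := by
  classical
  induction s using Finset.induction_on with
  | empty => simp [dirDer_zero]
  | insert a s ha ih => rw [Finset.sum_insert ha, Finset.sum_insert ha, dirDer_add, ih]

theorem dirDer_mul {m : ℕ} (z t : Fin m → K) (F G : MvPolynomial (Fin m) K) :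
    dirDer z t (F * G) = eval z F * dirDer z t G + eval z G * dirDer z t F := by
  simp only [dirDer, pderiv_mul, map_add, map_mul, Finset.mul_sum, ← Finset.sum_add_distrib]
  exact Finset.sum_congr rfl fun i _ => by ring

theorem dirDer_X {m : ℕ} (z t : Fin m → K) (i : Fin m) : dirDer z t (X i) = t i := by
  classical
  unfold dirDer
  rw [Finset.sum_eq_single i]
  · simp
  · intro b _ hb; simp [pderiv_X_of_ne hb.symm]
  · simp

theorem dirDer_C {m : ℕ} (z t : Fin m → K) (a : K) : dirDer z t (C a) = 0 := by
  simp [dirDer]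

theorem eval_rename_fst (z : Fin (n + n) → K) (a : MvPolynomial (Fin n) K) :
    eval z (rename (Fin.castAdd n) a) = eval (fstProj z) a := by
  rw [eval_rename]; rfl

theorem dirDer_rename (z t : Fin (n + n) → K) (a : MvPolynomial (Fin n) K) :
    dirDer z t (rename (Fin.castAdd n) a) = dirDer (fstProj z) (fstProj t) a := by
  induction a using MvPolynomial.induction_on with
  | C a => rw [rename_C, dirDer_C, dirDer_C]
  | add a b ha hb => rw [map_add, dirDer_add, dirDer_add, ha, hb]
  | mul_X a i ha =>
    rw [map_mul, rename_X, dirDer_mul, dirDer_mul, dirDer_X, dirDer_X, ha, eval_rename_fst]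
    simp [fstProj]

theorem dirDer_linForm (z t : Fin (n + n) → K) (u : Fin n → MvPolynomial (Fin n) K) :
    dirDer z t (linForm u) = ∑ i, (eval (fstProj z) (u i) * sndProj t i +
      sndProj z i * dirDer (fstProj z) (fstProj t) (u i)) := by
  unfold linForm
  rw [dirDer_sum]
  refine Finset.sum_congr rfl fun i _ => ?_
  rw [dirDer_mul, dirDer_X, dirDer_rename, eval_rename_fst, eval_X]
  rfl

theorem mem_tangentSub_bundle (hgen : vanishingIdeal K V = Ideal.span (Set.range f))
    (hI : vanishingIdeal K (tangentBundle V) = tanIdeal f) {z : Fin (n + n) → K}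
    (hz : z ∈ tangentBundle V) (t : Fin (n + n) → K) :
    t ∈ tangentSub (tangentBundle V) z ↔ fstProj t ∈ tangentSub V (fstProj z) ∧
      ∀ a ∈ vanishingIdeal K V, ∑ i, (eval (fstProj z) (pderiv i a) * sndProj t i +
        sndProj z i * dirDer (fstProj z) (fstProj t) (pderiv i a)) = 0 := by
  constructor
  · intro ht
    refine ⟨fun a ha => ?_, fun a ha => ?_⟩
    · have h := ht (rename (Fin.castAdd n) a) (by rw [hI]; exact rename_mem_tanIdeal hgen ha)
      exact (dirDer_rename z t a).symm.trans h
    · have h := ht (linForm (gradP a)) (by rw [hI]; exact linForm_grad_mem_tanIdeal hgen ha)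
      exact (dirDer_linForm z t (gradP a)).symm.trans h
  · rintro ⟨h1, h2⟩ F hF
    have hfI : ∀ j, f j ∈ vanishingIdeal K V := fun j => by
      rw [hgen]; exact Ideal.subset_span ⟨j, rfl⟩
    change dirDer z t F = 0
    have hvan : ∀ G ∈ tanIdeal f, eval z G = 0 := by
      intro G hG
      rw [← hI] at hG
      have := hG z hz
      rwa [aeval_eq_eval] at this
    rw [hI] at hF
    unfold tanIdeal at hF
    induction hF using Submodule.span_induction with
    | mem x hx =>
      rcases hx with ⟨j, rfl⟩ | ⟨j, rfl⟩
      · exact (dirDer_rename z t (f j)).trans (h1 _ (hfI j))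
      · exact (dirDer_linForm z t (gradP (f j))).trans (h2 _ (hfI j))
    | zero => exact dirDer_zero z t
    | add x y _ _ hx hy => rw [dirDer_add, hx, hy, add_zero]
    | smul c x hx' hx =>
      rw [smul_eq_mul, dirDer_mul, hx, hvan x hx', mul_zero, zero_mul, add_zero]

theorem tangentBundle_smooth [IsAlgClosed K]
    (hgen : vanishingIdeal K V = Ideal.span (Set.range f))
    (hs : IsSmoothVariety V)
    (S : Fin n → Fin n → MvPolynomial (Fin n) K)
    (hS : ∀ a ∈ vanishingIdeal K V, ∀ i, ∑ k, pderiv k a * S k i ∈ vanishingIdeal K V)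
    (hS' : ∀ k, Pi.single k 1 - S k ∈ gradMod V)
    (hI : vanishingIdeal K (tangentBundle V) = tanIdeal f)
    (hdim : varDim (tangentBundle V) = 2 * varDim V) :
    IsSmoothVariety (tangentBundle V) := by
  classical
  intro z hz
  set p := fstProj z with hp
  set v := sndProj z with hv
  have hpV : p ∈ V := hz.1
  have hvT : v ∈ tangentSub V p := hz.2
  -- extend `v` to a vector field `w`
  let w : Fin n → MvPolynomial (Fin n) K := fun k => ∑ l, S k l * C (v l)
  have hw1 : ∀ k, eval p (w k) = v k := by
    intro k
    have h := gradMod_pair (hS' k) hvT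
    simp only [Pi.sub_apply, map_sub, sub_mul, Finset.sum_sub_distrib] at h
    rw [Finset.sum_eq_single k (fun b _ hb => by simp [hb]) (by simp)] at h
    simp only [Pi.single_eq_same, map_one, one_mul, sub_eq_zero] at h
    simp only [w, map_sum, map_mul, eval_C]
    exact h.symm
  have hw2 : ∀ a ∈ vanishingIdeal K V, ∑ k, pderiv k a * w k ∈ vanishingIdeal K V := by
    intro a ha
    have : ∑ k, pderiv k a * w k = ∑ l, (∑ k, pderiv k a * S k l) * C (v l) := by
      simp only [w, Finset.mul_sum, Finset.sum_mul]
      rw [Finset.sum_comm]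
      simp only [mul_assoc]
    rw [this]
    exact Ideal.sum_mem _ fun l _ => Ideal.mul_mem_right _ _ (hS a ha l)
  -- the derivative of `w`
  let δ : (Fin n → K) →ₗ[K] (Fin n → K) :=
    { toFun := fun a k => dirDer p a (w k)
      map_add' := by
        intro a b; ext k
        simp [dirDer, mul_add, Finset.sum_add_distrib]
      map_smul' := by
        intro c a; ext k
        simp only [dirDer, Pi.smul_apply, smul_eq_mul, RingHom.id_apply, Finset.mul_sum]
        exact Finset.sum_congr rfl fun i _ => by ring }
  have hmem : ∀ t : Fin (n + n) → K, t ∈ tangentSub (tangentBundle V) z ↔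
      fstProj t ∈ tangentSub V p ∧ sndProj t - δ (fstProj t) ∈ tangentSub V p := by
    intro t
    rw [mem_tangentSub_bundle hgen hI hz]
    refine and_congr_right fun h1 => forall₂_congr fun a ha => ?_
    have h2 : dirDer p (fstProj t) (∑ k, pderiv k a * w k) = 0 := h1 _ (hw2 a ha)
    rw [dirDer_sum] at h2
    simp only [dirDer_mul, hw1] at h2
    have h3 : ∑ i, (eval p (pderiv i a) * sndProj t i +
          v i * dirDer p (fstProj t) (pderiv i a)) =
        ∑ i, eval p (pderiv i a) * (sndProj t - δ (fstProj t)) i := by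
      rw [← sub_zero (∑ i, (eval p (pderiv i a) * sndProj t i +
          v i * dirDer p (fstProj t) (pderiv i a))), ← h2, ← Finset.sum_sub_distrib]
      refine Finset.sum_congr rfl fun i _ => ?_
      simp only [Pi.sub_apply, δ, LinearMap.coe_mk, AddHom.coe_mk]
      ring
    rw [← hp, ← hv, h3]
  have hfa : ∀ a b : Fin n → K, fstProj (Fin.append a b) = a := by
    intro a b; ext i; simp [fstProj]
  have hsa : ∀ a b : Fin n → K, sndProj (Fin.append a b) = b := by
    intro a b; ext i; rw [sndProj, Fin.append_right]
  have hap : ∀ t : Fin (n + n) → K, Fin.append (fstProj t) (sndProj t) = t := by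
    intro t; exact Fin.append_castAdd_natAdd
  let e : tangentSub (tangentBundle V) z ≃ₗ[K] (tangentSub V p × tangentSub V p) :=
    { toFun := fun t => (⟨fstProj t.1, ((hmem t.1).1 t.2).1⟩,
        ⟨sndProj t.1 - δ (fstProj t.1), ((hmem t.1).1 t.2).2⟩)
      map_add' := by
        intro s t
        refine Prod.ext (Subtype.ext rfl) (Subtype.ext ?_)
        change sndProj (s.1 + t.1) - δ (fstProj s.1 + fstProj t.1) =
          (sndProj s.1 - δ (fstProj s.1)) + (sndProj t.1 - δ (fstProj t.1))
        rw [map_add]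
        change sndProj s.1 + sndProj t.1 - _ = _
        abel
      map_smul' := by
        intro c t
        refine Prod.ext (Subtype.ext rfl) (Subtype.ext ?_)
        change c • sndProj t.1 - δ (c • fstProj t.1) = c • (sndProj t.1 - δ (fstProj t.1))
        rw [map_smul, smul_sub]
      invFun := fun x => ⟨Fin.append x.1.1 (x.2.1 + δ x.1.1), by
        rw [hmem, hfa, hsa, add_sub_cancel_right]
        exact ⟨x.1.2, x.2.2⟩⟩
      left_inv := by
        intro t
        apply Subtype.ext
        change Fin.append (fstProj t.1) (sndProj t.1 - δ (fstProj t.1) + δ (fstProj t.1)) = t.1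
        rw [sub_add_cancel, hap]
      right_inv := by
        intro x
        refine Prod.ext (Subtype.ext ?_) (Subtype.ext ?_)
        · exact hfa _ _
        · change sndProj (Fin.append x.1.1 (x.2.1 + δ x.1.1)) -
            δ (fstProj (Fin.append x.1.1 (x.2.1 + δ x.1.1))) = x.2.1
          rw [hfa, hsa, add_sub_cancel_right] }
  have hd : Module.finrank K (tangentSub V p) = varDim V := by
    rw [← tangentDimAt_eq]; exact hs p hpV
  change tangentDimAt _ z = _
  rw [tangentDimAt_eq, e.finrank_eq, Module.finrank_prod, hd, hdim, two_mul]

end Smooth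

/-- For a smooth irreducible variety `V ⊆ A^n` of dimension `d`, the tangent bundle
`TV ⊆ A^{2n}` is a smooth irreducible variety of dimension `2d`; moreover, if
`I(V) = (f₁,…,f_r)` then `I(TV) = (f₁,…,f_r, ∇f₁·y, …, ∇f_r·y)`. -/
theorem tangentBundle_smooth_irreducible_and_ideal {K : Type} [Field K] [IsAlgClosed K]
    [CharZero K] {n r : ℕ} (V : Set (Fin n → K)) (h1 : IsIrreducibleVariety V)
    (h2 : IsSmoothVariety V) (f : Fin r → MvPolynomial (Fin n) K)
    (hgen : vanishingIdeal K V = Ideal.span (Set.range f)) :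
    IsIrreducibleVariety (tangentBundle V) ∧ IsSmoothVariety (tangentBundle V) ∧
      varDim (tangentBundle V) = 2 * varDim V ∧
      vanishingIdeal K (tangentBundle V) =
        Ideal.span ((Set.range fun j => rename (Fin.castAdd n) (f j)) ∪
          (Set.range fun j => ∑ i : Fin n,
            rename (Fin.castAdd n) (pderiv i (f j)) * X (Fin.natAdd n i))) := by
  have hV := h1.1
  have hprime := h1.2
  obtain ⟨S, hS, hS'⟩ := exists_splitting V hV hprime h2
  have hJ : (tanIdeal f).IsPrime := tanIdeal_prime hgen hprime S hS hS'
  have hZ := tangentBundle_eq_zeroLocus hV hgen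
  have hI : vanishingIdeal K (tangentBundle V) = tanIdeal f := by
    rw [hZ]
    exact IsPrime.vanishingIdeal_zeroLocus (tanIdeal f)
  have hdim := varDim_tangentBundle hV hgen hprime h2 hI
  exact ⟨⟨⟨_, hZ⟩, by rw [hI]; exact hJ⟩,
    tangentBundle_smooth hgen h2 S hS hS' hI hdim, hdim, hI⟩
end

section
/- Let V ⊆ A^n be a smooth irreducible algebraic variety. Then deg(TV) ≥ deg(V). -/
open MvPolynomial

open MvPolynomial

theorem dim_eq_of_int {A R : Type} [CommRing A] [CommRing R] (f : A →+* R)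
    (hi : Function.Injective f) (hf : f.IsIntegral) : ringKrullDim A = ringKrullDim R := by
  algebraize [f]
  have : Algebra.IsIntegral A R := ⟨hf⟩
  apply le_antisymm
  · refine iSup_le fun l => ?_
    have h0 : ∃ Q : Ideal R, Q.IsPrime ∧ Q.comap (algebraMap A R) = l.head.asIdeal :=
      by
        obtain ⟨Q, -, h⟩ := Ideal.exists_ideal_over_prime_of_isIntegral l.head.asIdeal (⊥ : Ideal R)
          ((Ideal.comap_bot_of_injective (algebraMap A R) hi).trans_le bot_le)
        exact ⟨Q, h⟩
    obtain ⟨Q, hQ, hc⟩ := h0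
    have : Q.LiesOver l.head.asIdeal := ⟨hc.symm⟩
    obtain ⟨L, hL, -⟩ := Ideal.exists_ltSeries_of_hasGoingUp l Q
    rw [← hL]
    exact le_iSup (fun (p : LTSeries (PrimeSpectrum R)) => ((p.length : ℕ) : WithBot ℕ∞)) L
  · refine Order.krullDim_le_of_strictMono (fun p => PrimeSpectrum.comap (algebraMap A R) p) ?_
    intro p q hpq
    exact Ideal.IsIntegral.comap_lt_comap (R := A) (A := R) hpq

theorem dim_poly (K : Type) [Field K] (s : ℕ) :
    ringKrullDim (MvPolynomial (Fin s) K) = s := by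
  rw [MvPolynomial.ringKrullDim_of_isNoetherianRing]
  simp [ringKrullDim_eq_zero_of_field]

theorem exists_noether (K R : Type) [Field K] [CommRing R] [Algebra K R] [Algebra.FiniteType K R]
    [Nontrivial R] : ∃ s : ℕ, ringKrullDim R = s ∧ ∃ g : MvPolynomial (Fin s) K →ₐ[K] R,
      Function.Injective g := by
  obtain ⟨s, g, hg, hgi⟩ := exists_integral_inj_algHom_of_fg K R
  exact ⟨s, by rw [← dim_poly K s]; exact (dim_eq_of_int _ hg hgi).symm, g, hg⟩

theorem trdeg_eq_dim (K R : Type) [Field K] [CommRing R] [Algebra K R] [Algebra.FiniteType K R]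
    [IsDomain R] (s : ℕ) (hs : ringKrullDim R = s) : Algebra.trdeg K R = s := by
  obtain ⟨s', g, hg, hgi⟩ := exists_integral_inj_algHom_of_fg K R
  have : ringKrullDim R = s' := by rw [← dim_poly K s']; exact (dim_eq_of_int _ hg hgi).symm
  have e : s' = s := by
    rw [this] at hs; exact_mod_cast hs
  subst e
  have hind : AlgebraicIndependent K (fun i => g (X i)) := by
    rw [AlgebraicIndependent]
    convert hg
    ext; simp
  have hb : IsTranscendenceBasis K (fun i => g (X i)) := by
    rw [hind.isTranscendenceBasis_iff_isAlgebraic]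
    have hadj : Algebra.adjoin K (Set.range fun i => g (X i)) = g.range := by
      rw [Algebra.adjoin_range_eq_range_aeval]
      congr 1; ext; simp
    rw [hadj]
    have : Algebra.IsIntegral g.range R := by
      refine ⟨fun x => ?_⟩
      obtain ⟨p, hp, hp0⟩ := hgi x
      refine ⟨p.map g.rangeRestrict.toRingHom, hp.map _, ?_⟩
      rw [Polynomial.eval₂_map]
      exact hp0
    infer_instance
  have := hb.cardinalMk_eq_trdeg
  simpa using this.symm

theorem exists_prime_inj {A R : Type} [CommRing A] [IsDomain A] [CommRing R] (f : A →+* R)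
    (hf : Function.Injective f) : ∃ P : Ideal R, P.IsPrime ∧
      Function.Injective ((Ideal.Quotient.mk P).comp f) := by
  have h := Ideal.exists_comap_eq_of_mem_minimalPrimes_of_injective hf (⊥ : Ideal A)
    (by rw [IsDomain.minimalPrimes_eq_singleton_bot]; rfl)
  obtain ⟨P, hP, h⟩ := h
  refine ⟨P, hP, ?_⟩
  rw [RingHom.injective_iff_ker_eq_bot, RingHom.ker_eq_comap_bot, ← Ideal.comap_comap,
    ← RingHom.ker_eq_comap_bot, Ideal.mk_ker, h]

theorem le_trdeg_of_inj {K R : Type} [Field K] [CommRing R] [Algebra K R] {ι : Type} [Fintype ι]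
    (g : MvPolynomial ι K →ₐ[K] R) (hg : Function.Injective g) :
    (Fintype.card ι : Cardinal) ≤ Algebra.trdeg K R := by
  have hind : AlgebraicIndependent K (fun i => g (X i)) := by
    rw [AlgebraicIndependent]
    convert hg
    ext; simp
  simpa using hind.cardinalMk_le_trdeg

theorem le_dim_of_inj {K R : Type} [Field K] [CommRing R] [Algebra K R] [Algebra.FiniteType K R]
    {ι : Type} [Fintype ι] (g : MvPolynomial ι K →ₐ[K] R) (hg : Function.Injective g) :
    (Fintype.card ι : WithBot ℕ∞) ≤ ringKrullDim R := by
  obtain ⟨P, hP, hPg⟩ := exists_prime_inj (g : MvPolynomial ι K →+* R) hg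
  have h1 := le_trdeg_of_inj ((Ideal.Quotient.mkₐ K P).comp g) hPg
  obtain ⟨s, hs, -⟩ := exists_noether K (R ⧸ P)
  rw [trdeg_eq_dim K (R ⧸ P) s hs] at h1
  refine le_trans ?_ (ringKrullDim_quotient_le P)
  rw [hs]; exact_mod_cast h1

theorem dim_le_of_trdeg {K R : Type} [Field K] [CommRing R] [Algebra K R] [Algebra.FiniteType K R]
    [Nontrivial R] (r : ℕ)
    (h : ∀ P : Ideal R, P.IsPrime → Algebra.trdeg K (R ⧸ P) ≤ (r : Cardinal)) :
    ringKrullDim R ≤ r := by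
  obtain ⟨s, hs, g, hg⟩ := exists_noether K R
  obtain ⟨P, hP, hPg⟩ := exists_prime_inj (g : MvPolynomial (Fin s) K →+* R) hg
  have h1 := le_trdeg_of_inj ((Ideal.Quotient.mkₐ K P).comp g) hPg
  have := h1.trans (h P hP)
  rw [hs]
  simp only [Fintype.card_fin] at this
  exact_mod_cast this

theorem single_eq_ite {K ι : Type} [Field K] [DecidableEq ι] (i : ι) :
    (Pi.single i 1 : ι → K) = fun j => if i = j then 1 else 0 := by
  ext j
  simp [Pi.single_apply, eq_comm]

theorem exists_linInd_subfamily {K E ι C : Type} [Field K] [AddCommGroup E] [Module K E]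
    [FiniteDimensional K E] [Fintype C] (v : ι → E) (hv : Submodule.span K (Set.range v) = ⊤)
    (hc : Module.finrank K E = Fintype.card C) :
    ∃ s : C → ι, LinearIndependent K (v ∘ s) := by
  obtain ⟨κ, a, -, hsp, hli⟩ := exists_linearIndependent' K v
  have b := Module.Basis.mk hli (by rw [hsp, hv])
  have : Fintype κ := FiniteDimensional.fintypeBasisIndex b
  have hcard : Fintype.card C = Fintype.card κ := by
    rw [← hc, Module.finrank_eq_card_basis b]
  let e := Fintype.equivOfCardEq hcard
  exact ⟨a ∘ e, hli.comp e e.injective⟩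

def tanSub {K : Type} [Field K] {n : ℕ} (W : Set (Fin n → K)) (p : Fin n → K) :
    Submodule K (Fin n → K) where
  carrier := tangentSpaceAt W p
  zero_mem' := by intro f _; simp
  add_mem' := by
    intro a b ha hb f hf
    have := ha f hf
    have := hb f hf
    simp_all [mul_add, Finset.sum_add_distrib]
  smul_mem' := by
    intro c a ha f hf
    have := ha f hf
    have h : ∀ i, eval p (pderiv i f) * (c • a) i = c * (eval p (pderiv i f) * a i) := by
      intro i; simp; ring
    simp only [h]
    rw [← Finset.mul_sum, this, mul_zero]

theorem mem_tanSub {K : Type} [Field K] {n : ℕ} (W : Set (Fin n → K)) (p y : Fin n → K) :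
    y ∈ tanSub W p ↔ ∀ f ∈ vanishingIdeal K W, ∑ i, eval p (pderiv i f) * y i = 0 := Iff.rfl

theorem finrank_tanSub {K : Type} [Field K] {n : ℕ} {W : Set (Fin n → K)} {p : Fin n → K}
    (h : IsSmoothAt W p) : Module.finrank K (tanSub W p) = varDim W := by
  rw [← h, tangentDimAt]
  have : Submodule.span K (tangentSpaceAt W p) = tanSub W p := Submodule.span_eq (tanSub W p)
  rw [this]

/-- the matrix of partial derivatives outside the free columns `s` -/
noncomputable def jacDet {K : Type} [Field K] {n d : ℕ} (s : Fin d → Fin n)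
    (f : {i // i ∉ Set.range s} → MvPolynomial (Fin n) K) : MvPolynomial (Fin n) K :=
  open Classical in
  Matrix.det (Matrix.of fun c c' : {i // i ∉ Set.range s} => pderiv c'.1 (f c))

theorem exists_minor {K : Type} [Field K] {n : ℕ} {W : Set (Fin n → K)} {p : Fin n → K}
    (h : IsSmoothAt W p) : ∃ (s : Fin (varDim W) → Fin n), Function.Injective s ∧
      ∃ f : {i // i ∉ Set.range s} → MvPolynomial (Fin n) K,
      (∀ c, f c ∈ vanishingIdeal K W) ∧ eval p (jacDet s f) ≠ 0 := by
  classical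
  have hfr := finrank_tanSub h
  set d := varDim W
  set T := tanSub W p
  let v : Fin n → Module.Dual K T := fun i => (LinearMap.proj i).comp T.subtype
  have hv : Submodule.span K (Set.range v) = ⊤ := by
    rw [eq_top_iff]
    rintro φ -
    obtain ⟨ψ, hψ⟩ := LinearMap.exists_extend φ
    have : φ = ∑ i, ψ (Pi.single i 1) • v i := by
      rw [← hψ]
      ext y
      conv_lhs => rw [LinearMap.comp_apply, LinearMap.pi_apply_eq_sum_univ ψ]
      simp only [LinearMap.coe_sum, Finset.sum_apply, LinearMap.smul_apply, smul_eq_mul]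
      refine Finset.sum_congr rfl fun i _ => ?_
      rw [mul_comm, ← single_eq_ite]
      rfl
    rw [this]
    exact Submodule.sum_mem _ fun i _ => Submodule.smul_mem _ _ (Submodule.subset_span ⟨i, rfl⟩)
  obtain ⟨s, hs⟩ := exists_linInd_subfamily (C := Fin d) v hv (by
    rw [Subspace.dual_finrank_eq, hfr, Fintype.card_fin])
  have hsinj : Function.Injective s := fun a b hab => hs.injective (by simp [hab])
  have hspan : Submodule.span K (Set.range (v ∘ s)) = ⊤ :=
    hs.span_eq_top_of_card_eq_finrank' (by rw [Subspace.dual_finrank_eq, hfr, Fintype.card_fin])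
  have hT0 : ∀ y ∈ T, (∀ j, y (s j) = 0) → y = 0 := by
    intro y hy hj
    have : ∀ φ : Module.Dual K T, φ ⟨y, hy⟩ = 0 := by
      intro φ
      have hφ : φ ∈ Submodule.span K (Set.range (v ∘ s)) := by rw [hspan]; trivial
      induction hφ using Submodule.span_induction with
      | mem x hx => obtain ⟨j, rfl⟩ := hx; exact hj j
      | zero => rfl
      | add a b _ _ ha hb => simp [ha, hb]
      | smul c a _ ha => simp [ha]
    have := (Module.forall_dual_apply_eq_zero_iff K (⟨y, hy⟩ : T)).1 this
    simpa using this
  let C := {i // i ∉ Set.range s}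
  let w : vanishingIdeal K W → (C → K) := fun f c => eval p (pderiv c.1 f.1)
  have hw : Submodule.span K (Set.range w) = ⊤ := by
    by_contra hne
    obtain ⟨g, hg0, hg⟩ := Submodule.exists_le_ker_of_lt_top _ (lt_top_iff_ne_top.2 hne)
    let a : C → K := fun c => g (Pi.single c 1)
    let y : Fin n → K := fun i => if h : i ∉ Set.range s then a ⟨i, h⟩ else 0
    have hyc : ∀ c : C, y c.1 = a c := fun c => dif_pos c.2
    have hys : ∀ i, i ∈ Set.range s → y i = 0 := fun i hi => dif_neg (not_not.2 hi)
    have hyT : y ∈ T := by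
      rw [mem_tanSub]
      intro f hf
      have h1 : g (w ⟨f, hf⟩) = 0 := hg (Submodule.subset_span ⟨⟨f, hf⟩, rfl⟩)
      rw [LinearMap.pi_apply_eq_sum_univ g] at h1
      rw [← h1]
      symm
      apply Fintype.sum_of_injective (fun c : C => c.1) Subtype.val_injective
      · intro i hi
        rw [hys i, mul_zero]
        by_contra h'
        exact hi ⟨⟨i, h'⟩, rfl⟩
      · intro c
        rw [hyc, ← single_eq_ite]
        rfl
    have hy0 := hT0 y hyT (fun j => hys _ ⟨j, rfl⟩)
    apply hg0
    apply LinearMap.pi_ext'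
    intro c
    ext
    have : a c = 0 := by rw [← hyc, hy0]; rfl
    simpa using this
  obtain ⟨r, hr⟩ := exists_linInd_subfamily (C := C) w hw (by simp)
  refine ⟨s, hsinj, fun c => (r c).1, fun c => (r c).2, ?_⟩
  rw [jacDet, RingHom.map_det]
  have : LinearIndependent K (Matrix.of (w ∘ r)).row := hr
  rw [Matrix.linearIndependent_rows_iff_isUnit, Matrix.isUnit_iff_isUnit_det] at this
  have h2 := this.ne_zero
  convert h2
  rfl

theorem append_natAdd' {K : Type} {n : ℕ} (x y : Fin n → K) (i : Fin n) :
    Fin.append x y (Fin.natAdd n i) = y i := Fin.append_right x y i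

theorem append_comp {K : Type} {n : ℕ} (x y : Fin n → K) :
    Fin.append x y ∘ Fin.castAdd n = x := by
  ext i; simp

theorem sum_split {K : Type} [CommRing K] {n d : ℕ} (s : Fin d → Fin n)
    (hs : Function.Injective s) [Fintype {i // i ∉ Set.range s}] (g : Fin n → K) :
    ∑ i, g i = ∑ c : {i // i ∉ Set.range s}, g c.1 + ∑ j, g (s j) := by
  classical
  rw [← Fintype.sum_subtype_add_sum_subtype (fun i => i ∈ Set.range s) g, add_comm]
  congr 1
  · convert rfl
  · symm
    convert Fintype.sum_equiv (Equiv.ofInjective s hs) (fun j => g (s j))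
      (fun i : {x // x ∈ Set.range s} => g i.1) (fun j => rfl)

theorem tan_surj {K : Type} [Field K] {n : ℕ} {W : Set (Fin n → K)} {p : Fin n → K}
    (h : IsSmoothAt W p) (s : Fin (varDim W) → Fin n) (hs : Function.Injective s)
    (f : {i // i ∉ Set.range s} → MvPolynomial (Fin n) K)
    (hf : ∀ c, f c ∈ vanishingIdeal K W) (hd : eval p (jacDet s f) ≠ 0)
    (y' : Fin (varDim W) → K) : ∃ y ∈ tangentSpaceAt W p, ∀ j, y (s j) = y' j := by
  classical
  let φ : tanSub W p →ₗ[K] (Fin (varDim W) → K) :=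
    (LinearMap.funLeft K K s).comp (tanSub W p).subtype
  have hinj : Function.Injective φ := by
    rw [injective_iff_map_eq_zero]
    rintro ⟨y, hy⟩ h0
    have h0' : ∀ j, y (s j) = 0 := fun j => congrFun h0 j
    rw [jacDet, RingHom.map_det] at hd
    have hC : (fun c : {i // i ∉ Set.range s} => y c.1) = 0 := by
      apply Matrix.eq_zero_of_mulVec_eq_zero hd
      ext c
      have := (mem_tanSub W p y).1 hy (f c) (hf c)
      rw [sum_split s hs] at this
      simp only [h0', mul_zero, Finset.sum_const_zero, add_zero] at this
      exact this
    ext i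
    by_cases hi : i ∈ Set.range s
    · obtain ⟨j, rfl⟩ := hi
      exact h0' j
    · exact congrFun hC ⟨i, hi⟩
  have hsurj : Function.Surjective φ :=
    (LinearMap.injective_iff_surjective_of_finrank_eq_finrank
      (by rw [finrank_tanSub h]; simp)).1 hinj
  obtain ⟨y, hy⟩ := hsurj y'
  exact ⟨y.1, y.2, fun j => congrFun hy j⟩

theorem varDim_spec {K : Type} [Field K] {n : ℕ} (W : Set (Fin n → K))
    (h : vanishingIdeal K W ≠ ⊤) :
    ringKrullDim (MvPolynomial (Fin n) K ⧸ vanishingIdeal K W) = (varDim W : ℕ) := by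
  have : Nontrivial (MvPolynomial (Fin n) K ⧸ vanishingIdeal K W) :=
    Ideal.Quotient.nontrivial_iff.2 h
  obtain ⟨s, hs, -⟩ := exists_noether K (MvPolynomial (Fin n) K ⧸ vanishingIdeal K W)
  rw [varDim, hs]
  rfl

theorem lower_dim {K : Type} [Field K] [IsAlgClosed K] {n : ℕ} (V : Set (Fin n → K))
    (h1 : IsIrreducibleVariety V) (h2 : IsSmoothVariety V) :
    ((varDim V + varDim V : ℕ) : WithBot ℕ∞) ≤
      ringKrullDim (MvPolynomial (Fin (n + n)) K ⧸ vanishingIdeal K (tangentBundle V)) := by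
  classical
  have hpr := h1.2
  have hne := hpr.ne_top
  obtain ⟨p, hp⟩ : V.Nonempty := by
    by_contra h
    rw [Set.not_nonempty_iff_eq_empty] at h
    exact hne (by rw [h]; exact vanishingIdeal_empty)
  obtain ⟨s, hs, f, hf, hdet⟩ := exists_minor (h2 p hp)
  have hdim := varDim_spec V hne
  have : Nontrivial (MvPolynomial (Fin n) K ⧸ vanishingIdeal K V) :=
    Ideal.Quotient.nontrivial_iff.2 hne
  obtain ⟨d', hd', g, hg⟩ := exists_noether K (MvPolynomial (Fin n) K ⧸ vanishingIdeal K V)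
  obtain rfl : d' = varDim V := by rw [hd'] at hdim; exact_mod_cast hdim
  choose t ht using fun i => Ideal.Quotient.mk_surjective (g (X i))
  -- evaluation of `g`
  have hgq : ∀ a : MvPolynomial (Fin (varDim V)) K, g a = Ideal.Quotient.mk _ (aeval t a) := by
    intro a
    have : g = (Ideal.Quotient.mkₐ K _).comp (aeval t) := by
      ext i
      simp [ht]
    rw [this]; rfl
  let Φ : MvPolynomial (Fin (varDim V) ⊕ Fin (varDim V)) K →ₐ[K] MvPolynomial (Fin (n + n)) K :=
    aeval (Sum.elim (fun j => X (Fin.natAdd n (s j))) (fun i => rename (Fin.castAdd n) (t i)))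
  let Ψ := (Ideal.Quotient.mkₐ K (vanishingIdeal K (tangentBundle V))).comp Φ
  have hΨ : Function.Injective Ψ := by
    rw [injective_iff_map_eq_zero]
    intro a ha
    by_contra ha0
    have hmem : Φ a ∈ vanishingIdeal K (tangentBundle V) := Ideal.Quotient.eq_zero_iff_mem.1 ha
    let b := sumAlgEquiv K (Fin (varDim V)) (Fin (varDim V)) a
    have hb : b ≠ 0 := by simpa [b] using ha0
    obtain ⟨m, hm⟩ := MvPolynomial.ne_zero_iff.1 hb
    have h3 : aeval t (coeff m b) ∉ vanishingIdeal K V := by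
      intro h
      have : g (coeff m b) = 0 := by rw [hgq]; exact Ideal.Quotient.eq_zero_iff_mem.2 h
      exact hm (hg (by rw [this, map_zero]))
    have h4 : jacDet s f ∉ vanishingIdeal K V := fun h => hdet (by
      have := h p hp
      simpa using this)
    have h5 : aeval t (coeff m b) * jacDet s f ∉ vanishingIdeal K V := by
      intro h
      rcases hpr.mem_or_mem h with h | h
      exacts [h3 h, h4 h]
    rw [mem_vanishingIdeal_iff] at h5
    push Not at h5
    obtain ⟨x, hx, hx0⟩ := h5
    rw [map_mul] at hx0
    have hx1 := left_ne_zero_of_mul hx0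
    have hx2 := right_ne_zero_of_mul hx0
    let ev : MvPolynomial (Fin (varDim V)) K →+* K := eval (fun i => eval x (t i))
    have hev : ev (coeff m b) ≠ 0 := by
      have e : (aeval x (aeval t (coeff m b)) : K) = ev (coeff m b) := by
        have : (aeval x).comp (aeval t) = (aeval (fun i => eval x (t i)) : _ →ₐ[K] K) := by
          ext i; simp [aeval_eq_eval]
        exact congrArg (fun φ => φ (coeff m b)) this
      rwa [← e]
    have hb1 : map ev b ≠ 0 := fun h => hev (by rw [← coeff_map, h, coeff_zero])
    obtain ⟨y', hy'⟩ : ∃ y' : Fin (varDim V) → K, eval y' (map ev b) ≠ 0 := by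
      by_contra! hh
      exact hb1 (MvPolynomial.funext (by simpa using hh))
    obtain ⟨y, hy, hyj⟩ := tan_surj (h2 x hx) s hs f hf (by simpa using hx2) y'
    have hz : Fin.append x y ∈ tangentBundle V := by
      have e1 : fstProj (Fin.append x y) = x := by ext i; simp [fstProj]
      have e2 : sndProj (Fin.append x y) = y := by ext i; simp only [sndProj, append_natAdd']
      refine ⟨?_, ?_⟩
      · rw [e1]; exact hx
      · rw [e1, e2]; exact hy
    have h6 := hmem _ hz
    apply hy'
    rw [← h6]
    have hcomp : (((eval y').comp (map ev)).comp
        (sumAlgEquiv K (Fin (varDim V)) (Fin (varDim V)) : _ →+* _)) =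
        (aeval (Fin.append x y) : MvPolynomial (Fin (n + n)) K →ₐ[K] K).toRingHom.comp
          Φ.toRingHom := by
      apply MvPolynomial.ringHom_ext
      · intro r
        simp [ev, sumAlgEquiv_C_inl]
      · rintro (j | i)
        · simp [Φ, sumAlgEquiv_X_inl, -Fin.natAdd_eq_addNat]
          exact (hyj j).symm
        · simp [Φ, sumAlgEquiv_X_inr, ev]
          rw [eval_rename, append_comp]
    exact congrArg (fun φ => φ a) hcomp
  have := le_dim_of_inj Ψ hΨ
  simpa using this

theorem trdeg_bound {K S B : Type} [Field K] [CommRing S] [IsDomain S] [Algebra K S]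
    [CommRing B] [Algebra K B] {n d : ℕ} (φ : B →ₐ[K] S) (hB : Algebra.trdeg K B = d)
    (y : Fin n → S) (s : Fin d → Fin n)
    (hgen : ∀ A : Subalgebra K S, (∀ b, φ b ∈ A) → (∀ i, y i ∈ A) → ∀ z, z ∈ A)
    (hy : ∀ i, i ∉ Set.range s → ∃ (b : B) (c : Fin d → B), φ b ≠ 0 ∧
      φ b * y i = ∑ j, φ (c j) * y (s j)) :
    Algebra.trdeg K S ≤ ((d + d : ℕ) : Cardinal) := by
  let A0 := φ.range
  have h1 : Algebra.trdeg K A0 ≤ d := by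
    rw [← hB]
    exact trdeg_le_of_surjective φ.rangeRestrict φ.rangeRestrict_surjective
  let B1 := Algebra.adjoin A0 (Set.range (y ∘ s))
  have hφ : ∀ b, φ b ∈ B1 := fun b => B1.algebraMap_mem (⟨φ b, b, rfl⟩ : A0)
  have hys : ∀ j, y (s j) ∈ B1 := fun j => Algebra.subset_adjoin ⟨j, rfl⟩
  have hmem : ∀ z ∈ B1, IsAlgebraic B1 z := fun z hz => isAlgebraic_algebraMap (⟨z, hz⟩ : B1)
  have halg : Algebra.IsAlgebraic B1 S := by
    constructor
    intro z
    rw [← Subalgebra.mem_algebraicClosure]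
    refine hgen ((Subalgebra.algebraicClosure B1 S).restrictScalars K) ?_ ?_ z
    · intro b
      exact hmem _ (hφ b)
    · intro i
      by_cases hi : i ∈ Set.range s
      · obtain ⟨j, rfl⟩ := hi
        exact hmem _ (hys j)
      · obtain ⟨b, c, hb, e⟩ := hy i hi
        refine IsAlgebraic.of_mul (y := φ b) (mem_nonZeroDivisors_of_ne_zero hb)
          (hmem _ (hφ b)) ?_
        rw [e]
        exact hmem _ (Subalgebra.sum_mem _ fun j _ => Subalgebra.mul_mem _ (hφ _) (hys j))
  have h2 : Algebra.trdeg A0 S ≤ d := by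
    refine (Algebra.IsAlgebraic.trdeg_le_cardinalMk A0 (Set.range (y ∘ s))).trans ?_
    refine Cardinal.mk_range_le.trans ?_
    simp
  rw [← trdeg_add_eq K A0]
  push_cast
  exact add_le_add h1 h2

theorem alg_closed_eq {K : Type} [Field K] {n : ℕ} {V : Set (Fin n → K)}
    (h : IsAlgebraicSet V) (x : Fin n → K) (hx : ∀ f ∈ vanishingIdeal K V, eval x f = 0) :
    x ∈ V := by
  obtain ⟨I, rfl⟩ := h
  intro f hf
  exact hx f (le_vanishingIdeal_zeroLocus I hf)

theorem rename_mem_TV {K : Type} [Field K] {n : ℕ} (V : Set (Fin n → K))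
    (f : MvPolynomial (Fin n) K) (hf : f ∈ vanishingIdeal K V) :
    rename (Fin.castAdd n) f ∈ vanishingIdeal K (tangentBundle V) := by
  intro z hz
  have := hf _ hz.1
  rw [aeval_rename]
  exact this

theorem deriv_mem_TV {K : Type} [Field K] {n : ℕ} (V : Set (Fin n → K))
    (f : MvPolynomial (Fin n) K) (hf : f ∈ vanishingIdeal K V) :
    ∑ i, rename (Fin.castAdd n) (pderiv i f) * X (Fin.natAdd n i) ∈
      vanishingIdeal K (tangentBundle V) := by
  intro z hz
  have := hz.2 _ hf
  rw [map_sum]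
  rw [← this]
  refine Finset.sum_congr rfl fun i _ => ?_
  rw [map_mul, aeval_rename, aeval_X]
  rfl

theorem upper_dim {K : Type} [Field K] [IsAlgClosed K] {n : ℕ} (V : Set (Fin n → K))
    (h1 : IsIrreducibleVariety V) (h2 : IsSmoothVariety V)
    (hne' : vanishingIdeal K (tangentBundle V) ≠ ⊤) :
    ringKrullDim (MvPolynomial (Fin (n + n)) K ⧸ vanishingIdeal K (tangentBundle V)) ≤
    ((varDim V + varDim V : ℕ) : WithBot ℕ∞) := by
  classical
  have hpr := h1.2
  have hne := hpr.ne_top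
  have : Nontrivial (MvPolynomial (Fin (n + n)) K ⧸ vanishingIdeal K (tangentBundle V)) :=
    Ideal.Quotient.nontrivial_iff.2 hne'
  refine dim_le_of_trdeg (K := K) _ fun P hP => ?_
  let π : MvPolynomial (Fin (n + n)) K →ₐ[K]
      (MvPolynomial (Fin (n + n)) K ⧸ vanishingIdeal K (tangentBundle V)) ⧸ P :=
    (Ideal.Quotient.mkₐ K P).comp (Ideal.Quotient.mkₐ K (vanishingIdeal K (tangentBundle V)))
  have hπs : Function.Surjective π :=
    (Ideal.Quotient.mk_surjective).comp (Ideal.Quotient.mk_surjective)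
  have hπ0 : ∀ f ∈ vanishingIdeal K (tangentBundle V), π f = 0 := by
    intro f hf
    show (Ideal.Quotient.mk P) (Ideal.Quotient.mk _ f) = 0
    rw [Ideal.Quotient.eq_zero_iff_mem.2 hf, map_zero]
  let P' := RingHom.ker π
  have hP' : P'.IsPrime := RingHom.ker_isPrime π
  obtain ⟨q, hq⟩ : (zeroLocus K P').Nonempty := by
    by_contra h
    rw [Set.not_nonempty_iff_eq_empty] at h
    have h3 := IsPrime.vanishingIdeal_zeroLocus (K := K) P'
    rw [h, vanishingIdeal_empty] at h3
    exact hP'.ne_top h3.symm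
  have hqV : fstProj q ∈ V := by
    apply alg_closed_eq h1.1
    intro f hf
    have := hq _ (hπ0 _ (rename_mem_TV V f hf))
    rw [aeval_rename] at this
    exact this
  obtain ⟨s, hs, f, hf, hdet⟩ := exists_minor (h2 _ hqV)
  let B := MvPolynomial (Fin n) K ⧸ vanishingIdeal K V
  have hBd : Algebra.trdeg K B = varDim V := trdeg_eq_dim K B _ (varDim_spec V hne)
  let φ : B →ₐ[K] ((MvPolynomial (Fin (n + n)) K ⧸ vanishingIdeal K (tangentBundle V)) ⧸ P) :=
    Ideal.Quotient.liftₐ _ (π.comp (rename (Fin.castAdd n)))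
      (fun a ha => hπ0 _ (rename_mem_TV V a ha))
  have hφ : ∀ a, φ (Ideal.Quotient.mk _ a) = π (rename (Fin.castAdd n) a) := fun a => rfl
  refine trdeg_bound φ hBd (fun i => π (X (Fin.natAdd n i))) s ?_ ?_
  · intro A hA1 hA2 z
    obtain ⟨w, rfl⟩ := hπs z
    have : A.comap π = ⊤ := by
      rw [eq_top_iff, ← MvPolynomial.adjoin_range_X, Algebra.adjoin_le_iff]
      rintro _ ⟨i, rfl⟩
      refine Fin.addCases (fun i => ?_) (fun i => ?_) i
      · have := hA1 (Ideal.Quotient.mk _ (X i))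
        rw [hφ, rename_X] at this
        exact this
      · exact hA2 i
    have hw : w ∈ A.comap π := by rw [this]; trivial
    exact hw
  · intro i hi
    let M : Matrix {i // i ∉ Set.range s} {i // i ∉ Set.range s} (MvPolynomial (Fin n) K) :=
      Matrix.of fun c c' => pderiv c'.1 (f c)
    have hM : M.det = jacDet s f := by
      rw [jacDet]
    refine ⟨Ideal.Quotient.mk _ M.det, fun j => Ideal.Quotient.mk _
      (- ∑ c, M.adjugate ⟨i, hi⟩ c * pderiv (s j) (f c)), ?_, ?_⟩
    · rw [hφ, hM]
      intro h0
      apply hdet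
      have := hq _ h0
      rw [aeval_rename] at this
      exact this
    · simp only [hφ]
      -- relation for each c
      let r : MvPolynomial (Fin n) K →+* _ := (π.comp (rename (Fin.castAdd n))).toRingHom
      let Y : Fin n → _ := fun i => π (X (Fin.natAdd n i))
      have hrel : ∀ c, ∑ c', r (M c c') * Y c'.1 + ∑ j, r (pderiv (s j) (f c)) * Y (s j) = 0 := by
        intro c
        have := hπ0 _ (deriv_mem_TV V _ (hf c))
        rw [map_sum] at this
        simp only [map_mul] at this
        rw [sum_split s hs] at this
        exact this
      show r M.det * Y i = ∑ j, r (- ∑ c, M.adjugate ⟨i, hi⟩ c * pderiv (s j) (f c)) * Y (s j)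
      have hadj : ∀ c', ∑ c, M.adjugate ⟨i, hi⟩ c * M c c' = if ⟨i, hi⟩ = c' then M.det else 0 := by
        intro c'
        have := congrFun (congrFun (Matrix.adjugate_mul M) ⟨i, hi⟩) c'
        rw [Matrix.mul_apply] at this
        rw [this, Matrix.smul_apply, Matrix.one_apply]
        simp
      have e1 : ∑ c, r (M.adjugate ⟨i, hi⟩ c) *
          (∑ c', r (M c c') * Y c'.1 + ∑ j, r (pderiv (s j) (f c)) * Y (s j)) = 0 := by
        simp only [hrel, mul_zero, Finset.sum_const_zero]
      simp only [mul_add, Finset.sum_add_distrib, Finset.mul_sum, ← mul_assoc, ← map_mul] at e1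
      rw [Finset.sum_comm] at e1
      nth_rewrite 2 [Finset.sum_comm] at e1
      simp only [← Finset.sum_mul, ← map_sum, hadj] at e1
      simp only [map_neg, neg_mul, Finset.sum_neg_distrib]
      rw [← add_eq_zero_iff_eq_neg, ← e1]
      congr 1
      rw [Finset.sum_eq_single ⟨i, hi⟩]
      · simp
      · intro b _ hb
        simp [Ne.symm hb]
      · simp

theorem TV_nonempty {K : Type} [Field K] {n : ℕ} {V : Set (Fin n → K)} (hV : V.Nonempty) :
    vanishingIdeal K (tangentBundle V) ≠ ⊤ := by
  obtain ⟨p, hp⟩ := hV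
  intro h
  have h1 : (1 : MvPolynomial (Fin (n + n)) K) ∈ vanishingIdeal K (tangentBundle V) := by
    rw [h]; trivial
  have hz : Fin.append p 0 ∈ tangentBundle V := by
    have e1 : fstProj (Fin.append p 0) = p := by ext i; simp [fstProj]
    have e2 : sndProj (Fin.append p (0 : Fin n → K)) = 0 := by
      ext i; simp only [sndProj, append_natAdd']
    refine ⟨?_, ?_⟩
    · rw [e1]; exact hp
    · rw [e1, e2]; exact (tanSub V p).zero_mem
  have := h1 _ hz
  simp at this

theorem varDim_TV {K : Type} [Field K] [IsAlgClosed K] {n : ℕ} (V : Set (Fin n → K))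
    (h1 : IsIrreducibleVariety V) (h2 : IsSmoothVariety V) :
    varDim (tangentBundle V) = varDim V + varDim V := by
  have hV : V.Nonempty := by
    by_contra h
    rw [Set.not_nonempty_iff_eq_empty] at h
    exact h1.2.ne_top (by rw [h]; exact vanishingIdeal_empty)
  have hne := TV_nonempty hV
  have ha := lower_dim V h1 h2
  have hb := upper_dim V h1 h2 hne
  rw [varDim_spec _ hne] at ha hb
  have := le_antisymm hb ha
  exact_mod_cast this

theorem exists_point {K T : Type} [Field K] [IsAlgClosed K] [CommRing T] [Algebra K T]
    [Algebra.FiniteType K T] [Nontrivial T] : Nonempty (T →ₐ[K] K) := by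
  obtain ⟨m, hm⟩ := Ideal.exists_maximal T
  let : Field (T ⧸ m) := Ideal.Quotient.field m
  have : Module.Finite K (T ⧸ m) := finite_of_finite_type_of_isJacobsonRing K (T ⧸ m)
  have : Algebra.IsAlgebraic K (T ⧸ m) := Algebra.IsAlgebraic.of_finite K _
  exact ⟨(IsAlgClosed.lift : (T ⧸ m) →ₐ[K] K).comp (Ideal.Quotient.mkₐ K m)⟩

theorem ext_of_prime {C R K : Type} [CommRing C] [CommRing R] [Field K] [IsAlgClosed K]
    (f : C →+* R) (hft : f.FiniteType) (φ : C →+* K) (Q : Ideal R) [Q.IsPrime]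
    (hQ : Q.comap f = RingHom.ker φ) : ∃ ψ : R →+* K, ψ.comp f = φ := by
  have hpr : (RingHom.ker φ).IsPrime := RingHom.ker_isPrime φ
  let C' := C ⧸ RingHom.ker φ
  let f' : C' →+* R ⧸ Q := Ideal.quotientMap Q f hQ.ge
  have hf' : Function.Injective f' := Ideal.quotientMap_injective' hQ.le
  let φ' : C' →+* K := RingHom.kerLift φ
  have hφ' : Function.Injective φ' := RingHom.kerLift_injective φ
  let : Algebra C' (R ⧸ Q) := f'.toAlgebra
  let : Algebra C' K := φ'.toAlgebra
  have hff : f'.FiniteType := by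
    apply RingHom.FiniteType.of_comp_finiteType (f := Ideal.Quotient.mk (RingHom.ker φ))
    have : f'.comp (Ideal.Quotient.mk (RingHom.ker φ)) = (Ideal.Quotient.mk Q).comp f := by
      ext; rfl
    rw [this]
    exact hft.comp_surjective Ideal.Quotient.mk_surjective
  have : Algebra.FiniteType C' (R ⧸ Q) := hff
  have : Nontrivial (TensorProduct C' K (R ⧸ Q)) :=
    Algebra.TensorProduct.nontrivial_of_algebraMap_injective_of_isDomain C' K (R ⧸ Q) hφ' hf'
  obtain ⟨χ⟩ := exists_point (K := K) (T := TensorProduct C' K (R ⧸ Q))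
  refine ⟨(χ : _ →+* K).comp ((Algebra.TensorProduct.includeRight :
    (R ⧸ Q) →ₐ[C'] TensorProduct C' K (R ⧸ Q)).toRingHom.comp (Ideal.Quotient.mk Q)), ?_⟩
  ext c
  have h1 : (Algebra.TensorProduct.includeRight : (R ⧸ Q) →ₐ[C'] TensorProduct C' K (R ⧸ Q))
      (algebraMap C' (R ⧸ Q) (Ideal.Quotient.mk _ c)) =
      algebraMap K _ (algebraMap C' K (Ideal.Quotient.mk _ c)) := by
    rw [AlgHom.commutes]
    exact IsScalarTower.algebraMap_apply C' K _ _
  show χ ((Algebra.TensorProduct.includeRight : (R ⧸ Q) →ₐ[C'] TensorProduct C' K (R ⧸ Q))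
      (algebraMap C' (R ⧸ Q) (Ideal.Quotient.mk _ c))) = φ c
  rw [h1, AlgHom.commutes]
  rfl

theorem ext_lemma {C R : Type} [CommRing C] [IsDomain C] [IsNoetherianRing C]
    [CommRing R] (f : C →+* R) (hf : Function.Injective f)
    (hft : f.FiniteType) (K : Type) [Field K] [IsAlgClosed K] :
    ∃ h : C, h ≠ 0 ∧ ∀ φ : C →+* K, φ h ≠ 0 → ∃ ψ : R →+* K, ψ.comp f = φ := by
  have hfp : f.FinitePresentation := (RingHom.FinitePresentation.of_finiteType).1 hft
  obtain ⟨S, hS⟩ := PrimeSpectrum.exists_constructibleSetData_iff.2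
    (PrimeSpectrum.isConstructible_range_comap hfp)
  obtain ⟨P, hP, hPi⟩ := exists_prime_inj f hf
  have hbot : (⟨⊥, Ideal.isPrime_bot⟩ : PrimeSpectrum C) ∈ S.toSet := by
    rw [hS]
    refine ⟨⟨P, hP⟩, ?_⟩
    ext1
    show P.comap f = ⊥
    have := (RingHom.injective_iff_ker_eq_bot _).1 hPi
    rw [← this, ← RingHom.comap_ker, Ideal.mk_ker]
  obtain ⟨D, hD, hDb⟩ := Set.mem_iUnion₂.1 hbot
  refine ⟨D.f, fun h0 => hDb.2 (by simp [h0]), fun φ hφ => ?_⟩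
  have hpr : (RingHom.ker φ).IsPrime := RingHom.ker_isPrime φ
  have : (⟨RingHom.ker φ, hpr⟩ : PrimeSpectrum C) ∈ S.toSet := by
    refine Set.mem_iUnion₂.2 ⟨D, hD, ?_, ?_⟩
    · have h1 := hDb.1
      rw [PrimeSpectrum.mem_zeroLocus] at h1 ⊢
      exact h1.trans (fun x hx => by
        have : x = 0 := hx
        rw [this]; exact (RingHom.ker φ).zero_mem)
    · intro h1
      rw [PrimeSpectrum.mem_zeroLocus] at h1
      exact hφ (h1 rfl)
  rw [hS] at this
  obtain ⟨⟨Q, hQ⟩, hQ'⟩ := this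
  have h3 : Q.comap f = RingHom.ker φ := congrArg PrimeSpectrum.asIdeal hQ'
  exact ext_of_prime f hft φ Q h3

/-- solutions of a polynomial system specialised along `φ` -/
def solSet {A K : Type} [CommRing A] [Field K] {N : ℕ} (J : Set (MvPolynomial (Fin N) A))
    (φ : A →+* K) : Set (Fin N → K) := {z | ∀ f ∈ J, eval₂ φ z f = 0}

section

variable {A K : Type} [CommRing A] [Field K] {N : ℕ}

/-- the ideal of relations -/
noncomputable def relIdeal (J : Set (MvPolynomial (Fin N) A)) (I : Ideal A) : Ideal (MvPolynomial (Fin N) A) :=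
  Ideal.span J ⊔ I.map C

/-- the structure map -/
noncomputable def relC (J : Set (MvPolynomial (Fin N) A)) (I : Ideal A) :
    A ⧸ I →+* MvPolynomial (Fin N) A ⧸ relIdeal J I :=
  Ideal.Quotient.lift I ((Ideal.Quotient.mk (relIdeal J I)).comp C) (fun a ha =>
    Ideal.Quotient.eq_zero_iff_mem.2
      ((le_sup_right : I.map C ≤ relIdeal J I) (Ideal.mem_map_of_mem C ha)))

/-- the coordinate map -/
noncomputable def relX (J : Set (MvPolynomial (Fin N) A)) (I : Ideal A) (i : Fin N) :
    Polynomial (A ⧸ I) →+* MvPolynomial (Fin N) A ⧸ relIdeal J I :=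
  Polynomial.eval₂RingHom (relC J I) (Ideal.Quotient.mk _ (X i))

theorem relX_ft (J : Set (MvPolynomial (Fin N) A)) (I : Ideal A) (i : Fin N) :
    (relX J I i).FiniteType := by
  apply RingHom.FiniteType.of_comp_finiteType
    (f := Polynomial.C.comp (Ideal.Quotient.mk I))
  have : (relX J I i).comp (Polynomial.C.comp (Ideal.Quotient.mk I)) =
      (Ideal.Quotient.mk (relIdeal J I)).comp C := by
    ext a
    simp [relX, relC]
  rw [this]
  apply RingHom.FiniteType.comp_surjective _ Ideal.Quotient.mk_surjective
  have : Algebra.FiniteType A (MvPolynomial (Fin N) A) := inferInstance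
  exact (RingHom.finiteType_algebraMap).2 this

/-- a solution gives a ring hom -/
theorem sol_hom (J : Set (MvPolynomial (Fin N) A)) (I : Ideal A) (φ : A →+* K)
    (hφ : ∀ a ∈ I, φ a = 0) (z : Fin N → K) (hz : z ∈ solSet J φ) (i : Fin N)
    (q : Polynomial (A ⧸ I)) (hq : relX J I i q = 0) :
    (q.map (Ideal.Quotient.lift I φ hφ)).eval (z i) = 0 := by
  have hle : relIdeal J I ≤ RingHom.ker (eval₂Hom φ z) := by
    refine sup_le ?_ ?_
    · rw [Ideal.span_le]
      exact fun f hf => hz f hf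
    · rw [Ideal.map_le_iff_le_comap]
      intro a ha
      simp [hφ a ha]
  let ψ : MvPolynomial (Fin N) A ⧸ relIdeal J I →+* K :=
    Ideal.Quotient.lift _ (eval₂Hom φ z) (fun a ha => hle ha)
  have h : ψ.comp (relX J I i) =
      Polynomial.eval₂RingHom (Ideal.Quotient.lift I φ hφ) (z i) := by
    apply Polynomial.ringHom_ext'
    · ext a
      simp [relX, relC]
      exact eval₂_C φ z a
    · simp [relX]
      exact eval₂_X φ z i
  have h2 := congrArg (fun g => g q) h
  simp only [RingHom.comp_apply, hq, map_zero] at h2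
  rw [Polynomial.eval_map]
  exact h2.symm

theorem hom_sol (J : Set (MvPolynomial (Fin N) A)) (I : Ideal A) (φ : A →+* K)
    (hφ : ∀ a ∈ I, φ a = 0) (i : Fin N) (t : K)
    (ψ : MvPolynomial (Fin N) A ⧸ relIdeal J I →+* K)
    (hψ : ψ.comp (relX J I i) = Polynomial.eval₂RingHom (Ideal.Quotient.lift I φ hφ) t) :
    ∃ z ∈ solSet J φ, z i = t := by
  refine ⟨fun j => ψ (Ideal.Quotient.mk _ (X j)), ?_, ?_⟩
  · intro f hf
    have : ψ.comp (Ideal.Quotient.mk _) = eval₂Hom φ (fun j => ψ (Ideal.Quotient.mk _ (X j))) := by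
      apply MvPolynomial.ringHom_ext
      · intro a
        have := congrArg (fun g => g (Polynomial.C (Ideal.Quotient.mk I a))) hψ
        simpa [relX, relC] using this
      · intro j; simp
    have h2 := congrArg (fun g => g f) this
    have h3 : (Ideal.Quotient.mk (relIdeal J I)) f = 0 :=
      Ideal.Quotient.eq_zero_iff_mem.2 ((le_sup_left : Ideal.span J ≤ relIdeal J I)
        (Ideal.subset_span hf))
    simp only [RingHom.comp_apply, h3, map_zero] at h2
    exact h2.symm
  · have := congrArg (fun g => g Polynomial.X) hψ
    simpa [relX] using this

theorem bound_step [IsAlgClosed K] [IsNoetherianRing A] (J : Set (MvPolynomial (Fin N) A))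
    (I : Ideal A) (hI : I.IsPrime) : ∃ a : A, a ∉ I ∧ ∃ B : ℕ, ∀ φ : A →+* K,
      (∀ x ∈ I, φ x = 0) → φ a ≠ 0 → (solSet J φ).Finite → (solSet J φ).ncard ≤ B := by
  classical
  by_cases hc : ∃ i, Function.Injective (relX J I i)
  · obtain ⟨i, hi⟩ := hc
    obtain ⟨h, h0, hext⟩ := ext_lemma (relX J I i) hi (relX_ft J I i) K
    obtain ⟨a, ha⟩ := Ideal.Quotient.mk_surjective h.leadingCoeff
    refine ⟨a, fun haI => ?_, 0, fun φ hφ hφa hfin => ?_⟩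
    · rw [Ideal.Quotient.eq_zero_iff_mem.2 haI] at ha
      exact h0 (Polynomial.leadingCoeff_eq_zero.1 ha.symm)
    · exfalso
      set φ' := Ideal.Quotient.lift I φ hφ
      have hne : h.map φ' ≠ 0 := by
        intro h1
        have h2 : (h.map φ').coeff h.natDegree = 0 := by rw [h1]; simp
        rw [Polynomial.coeff_map, Polynomial.coeff_natDegree, ← ha] at h2
        exact hφa h2
      have hsub : {t : K | (h.map φ').eval t = 0}ᶜ ⊆ (fun z : Fin N → K => z i) '' solSet J φ := by
        intro t ht
        obtain ⟨ψ, hψ⟩ := hext (Polynomial.eval₂RingHom φ' t) (by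
          rw [Set.mem_compl_iff, Set.mem_ofPred_eq, Polynomial.eval_map] at ht
          exact ht)
        exact hom_sol J I φ hφ i t ψ hψ
      have hf1 : {t : K | (h.map φ').eval t = 0}.Finite := by
        refine ((h.map φ').roots.toFinset.finite_toSet).subset fun t ht => ?_
        simpa [hne] using ht
      have hinf : Infinite K := IsAlgClosed.instInfinite
      exact hf1.infinite_compl ((hfin.image _).subset hsub)
  · push Not at hc
    have : ∀ i, ∃ q, q ≠ 0 ∧ relX J I i q = 0 := by
      intro i
      have := hc i
      rw [injective_iff_map_eq_zero] at this
      push Not at this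
      obtain ⟨q, h1, h2⟩ := this
      exact ⟨q, h2, h1⟩
    choose q hq0 hq using this
    obtain ⟨a, ha⟩ := Ideal.Quotient.mk_surjective (∏ i, (q i).leadingCoeff)
    refine ⟨a, fun haI => ?_, ∏ i, (q i).natDegree, fun φ hφ hφa hfin => ?_⟩
    · rw [Ideal.Quotient.eq_zero_iff_mem.2 haI] at ha
      have := Finset.prod_eq_zero_iff.1 ha.symm
      obtain ⟨i, -, hi⟩ := this
      exact hq0 i (Polynomial.leadingCoeff_eq_zero.1 hi)
    · set φ' := Ideal.Quotient.lift I φ hφ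
      have hφ' : ∏ i, φ' (q i).leadingCoeff ≠ 0 := by
        rw [← map_prod, ← ha]; exact hφa
      have hne : ∀ i, (q i).map φ' ≠ 0 := by
        intro i h1
        have h2 : ((q i).map φ').coeff (q i).natDegree = 0 := by rw [h1]; simp
        rw [Polynomial.coeff_map, Polynomial.coeff_natDegree] at h2
        exact hφ' (Finset.prod_eq_zero (Finset.mem_univ i) h2)
      have hsub : solSet J φ ⊆
          (Fintype.piFinset fun i => ((q i).map φ').roots.toFinset : Finset (Fin N → K)) := by
        intro z hz
        rw [Finset.mem_coe, Fintype.mem_piFinset]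
        intro i
        rw [Multiset.mem_toFinset, Polynomial.mem_roots (hne i)]
        exact sol_hom J I φ hφ z hz i (q i) (hq i)
      refine (Set.ncard_le_ncard hsub (Finset.finite_toSet _)).trans ?_
      rw [Set.ncard_coe_finset, Fintype.card_piFinset]
      refine Finset.prod_le_prod' fun i _ => ?_
      refine (Multiset.toFinset_card_le _).trans ?_
      refine (Polynomial.card_roots' _).trans ?_
      exact Polynomial.natDegree_map_le

theorem bound_ideal [IsAlgClosed K] [IsNoetherianRing A] (J : Set (MvPolynomial (Fin N) A))
    (I : Ideal A) : ∃ B : ℕ, ∀ φ : A →+* K,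
      (∀ x ∈ I, φ x = 0) → (solSet J φ).Finite → (solSet J φ).ncard ≤ B := by
  induction I using IsNoetherian.induction with
  | hgt I ih =>
  have key : ∀ a, a ∉ I → ∃ B : ℕ, ∀ φ : A →+* K, (∀ x ∈ I, φ x = 0) → φ a = 0 →
      (solSet J φ).Finite → (solSet J φ).ncard ≤ B := by
    intro a ha
    have hlt : I < I ⊔ Ideal.span {a} := by
      refine lt_of_le_of_ne le_sup_left fun h => ha ?_
      rw [h]
      exact (le_sup_right : Ideal.span {a} ≤ I ⊔ Ideal.span {a}) (Ideal.mem_span_singleton_self a)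
    obtain ⟨B, hB⟩ := ih _ hlt
    refine ⟨B, fun φ h1 h2 h3 => hB φ ?_ h3⟩
    have : I ⊔ Ideal.span {a} ≤ RingHom.ker φ := by
      refine sup_le h1 ?_
      rw [Ideal.span_le, Set.singleton_subset_iff]
      exact h2
    exact fun x hx => this hx
  by_cases hpr : Ideal.IsPrime I
  · obtain ⟨a, ha, B, hB⟩ := bound_step (K := K) J I hpr
    obtain ⟨B', hB'⟩ := key a ha
    refine ⟨max B B', fun φ h1 h2 => ?_⟩
    by_cases h : φ a = 0
    · exact (hB' φ h1 h h2).trans (le_max_right _ _)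
    · exact (hB φ h1 h h2).trans (le_max_left _ _)
  · rw [Ideal.not_isPrime_iff] at hpr
    rcases hpr with rfl | ⟨x, hx, y, hy, hxy⟩
    · refine ⟨0, fun φ h1 => ?_⟩
      have := h1 1 trivial
      simp at this
    · obtain ⟨B, hB⟩ := key x hx
      obtain ⟨B', hB'⟩ := key y hy
      refine ⟨max B B', fun φ h1 h2 => ?_⟩
      have := h1 _ hxy
      rw [map_mul] at this
      rcases mul_eq_zero.1 this with h | h
      · exact (hB φ h1 h h2).trans (le_max_left _ _)
      · exact (hB' φ h1 h h2).trans (le_max_right _ _)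

end

theorem exists_eqs {K : Type} [Field K] {N : ℕ} (L : AffineSubspace K (Fin N → K))
    (p : Fin N → K) (hp : p ∈ L) : ∃ (M : Fin N → Fin N → K) (b : Fin N → K),
      ∀ z, z ∈ L ↔ ∀ i, ∑ j, M i j * z j = b i := by
  obtain ⟨W, hW⟩ := L.direction.exists_isCompl
  let π : (Fin N → K) →ₗ[K] (Fin N → K) := Submodule.projection _ _ hW.symm
  have hker : LinearMap.ker π = L.direction := by
    exact Submodule.ker_projection _
  refine ⟨fun i j => π (Pi.single j 1) i, π p, fun z => ?_⟩
  have h1 : ∀ i, ∑ j, π (Pi.single j 1) i * z j = π z i := by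
    intro i
    rw [LinearMap.pi_apply_eq_sum_univ π z]
    simp only [Finset.sum_apply, Pi.smul_apply, smul_eq_mul]
    refine Finset.sum_congr rfl fun j _ => ?_
    rw [mul_comm, ← single_eq_ite]
  simp only [h1]
  rw [← _root_.funext_iff, ← sub_eq_zero, ← map_sub, ← LinearMap.mem_ker, hker]
  have := AffineSubspace.vsub_right_mem_direction_iff_mem hp z
  rw [← this]; rfl

theorem bound_affine {K : Type} [Field K] [IsAlgClosed K] {N : ℕ}
    (F : Set (MvPolynomial (Fin N) K)) : ∃ B : ℕ, ∀ L : AffineSubspace K (Fin N → K),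
      ({z | ∀ f ∈ F, eval z f = 0} ∩ (L : Set (Fin N → K))).Finite →
      ({z | ∀ f ∈ F, eval z f = 0} ∩ (L : Set (Fin N → K))).ncard ≤ B := by
  let A := MvPolynomial ((Fin N × Fin N) ⊕ Fin N) K
  let J : Set (MvPolynomial (Fin N) A) := (map C '' F) ∪
    Set.range (fun i : Fin N => ∑ j, C (X (Sum.inl (i, j)) : A) * X j - C (X (Sum.inr i) : A))
  obtain ⟨B, hB⟩ := bound_ideal (K := K) J ⊥
  refine ⟨B, fun L hfin => ?_⟩
  rcases Set.eq_empty_or_nonempty (L : Set (Fin N → K)) with he | ⟨p, hp⟩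
  · rw [he]; simp
  obtain ⟨M, b, hMb⟩ := exists_eqs L p hp
  let φ : A →+* K := eval (Sum.elim (fun ij => M ij.1 ij.2) b)
  have hX : ∀ v, φ (X v) = Sum.elim (fun ij => M ij.1 ij.2) b v := fun v => eval_X v
  have hC : ∀ a : K, φ (C a) = a := fun a => eval_C a
  have hS : solSet J φ = {z | ∀ f ∈ F, eval z f = 0} ∩ (L : Set (Fin N → K)) := by
    ext z
    have e1 : ∀ f : MvPolynomial (Fin N) K, eval₂ φ z (map C f) = eval z f := by
      intro f
      rw [eval₂_map]
      have : φ.comp C = RingHom.id K := by ext a; exact hC a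
      rw [this]; rfl
    constructor
    · intro hz
      refine ⟨fun f hf => ?_, (hMb z).2 fun i => ?_⟩
      · rw [← e1]; exact hz _ (Or.inl ⟨f, hf, rfl⟩)
      · have := hz _ (Or.inr ⟨i, rfl⟩)
        simp [hX, eval₂_sum, eval₂_sub] at this
        exact sub_eq_zero.1 this
    · rintro ⟨h1, h2⟩ f (⟨g, hg, rfl⟩ | ⟨i, rfl⟩)
      · rw [e1]; exact h1 g hg
      · have := (hMb z).1 h2 i
        simp [hX, eval₂_sum, eval₂_sub]
        exact sub_eq_zero.2 this
  rw [← hS] at hfin ⊢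
  exact hB φ (by simp) hfin

theorem common_compl {K E : Type} [Field K] [Infinite K] [AddCommGroup E] [Module K E]
    [FiniteDimensional K E] (s : Finset (Submodule K E)) (hs : s.Nonempty) (d : ℕ)
    (hd : ∀ T ∈ s, Module.finrank K T = d) (k : ℕ) (hk : k + d ≤ Module.finrank K E) :
    ∃ M : Submodule K E, Module.finrank K M = k ∧ ∀ T ∈ s, ∀ x ∈ M, x ∈ T → x = 0 := by
  classical
  induction k with
  | zero => exact ⟨⊥, by simp, fun T _ x hx _ => hx⟩
  | succ k ih =>
    obtain ⟨M, hM, hdis⟩ := ih (by omega)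
    have htop : ⊤ ∉ s.image (fun T => M ⊔ T) := by
      intro h
      obtain ⟨T, hT, h⟩ := Finset.mem_image.1 h
      have h1 := Submodule.finrank_sup_add_finrank_inf_eq M T
      rw [h, finrank_top, hM, hd T hT] at h1
      omega
    have h2 := Subspace.biUnion_ne_univ_of_top_notMem htop
    obtain ⟨v, hv⟩ := (Set.ne_univ_iff_exists_notMem _).1 h2
    have hv' : ∀ T ∈ s, v ∉ M ⊔ T := by
      intro T hT h
      exact hv (Set.mem_iUnion₂.2 ⟨M ⊔ T, Finset.mem_image_of_mem _ hT, h⟩)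
    obtain ⟨T0, hT0⟩ := hs
    have hvM : v ∉ M := fun h => hv' T0 hT0 ((le_sup_left : M ≤ M ⊔ T0) h)
    have hv0 : v ≠ 0 := fun h => hvM (by rw [h]; exact M.zero_mem)
    refine ⟨M ⊔ Submodule.span K {v}, ?_, ?_⟩
    · have h1 := Submodule.finrank_sup_add_finrank_inf_eq M (Submodule.span K {v})
      have h3 : M ⊓ Submodule.span K {v} = ⊥ := by
        rw [eq_bot_iff]
        rintro x ⟨hx, hxv⟩
        obtain ⟨c, rfl⟩ := Submodule.mem_span_singleton.1 hxv
        by_cases hc : c = 0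
        · simp [hc]
        · exact absurd ((Submodule.smul_mem_iff M hc).1 hx) hvM
      rw [h3, finrank_bot, hM, finrank_span_singleton hv0] at h1
      omega
    · intro T hT x hx hxT
      obtain ⟨m, hm, w, hw, rfl⟩ := Submodule.mem_sup.1 hx
      obtain ⟨c, rfl⟩ := Submodule.mem_span_singleton.1 hw
      by_cases hc : c = 0
      · rw [hc, zero_smul, add_zero] at hxT ⊢
        exact hdis T hT m hm hxT
      · exfalso
        apply hv' T hT
        rw [← Submodule.smul_mem_iff (M ⊔ T) hc]
        have : c • v = -m + (m + c • v) := by abel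
        rw [this]
        exact Submodule.add_mem_sup (M.neg_mem hm) hxT

/-- product of subspaces -/
def prodSub {K : Type} [Field K] {n : ℕ} (P M : Submodule K (Fin n → K)) :
    Submodule K (Fin (n + n) → K) where
  carrier := {w | fstProj w ∈ P ∧ sndProj w ∈ M}
  zero_mem' := ⟨P.zero_mem, M.zero_mem⟩
  add_mem' := fun ha hb => ⟨P.add_mem ha.1 hb.1, M.add_mem ha.2 hb.2⟩
  smul_mem' := fun c _ ha => ⟨P.smul_mem c ha.1, M.smul_mem c ha.2⟩

theorem fst_append {K : Type} {n : ℕ} (x y : Fin n → K) : fstProj (Fin.append x y) = x := by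
  ext i; simp [fstProj]

theorem snd_append {K : Type} {n : ℕ} (x y : Fin n → K) : sndProj (Fin.append x y) = y := by
  ext i; simp only [sndProj, append_natAdd']

theorem append_proj {K : Type} {n : ℕ} (z : Fin (n + n) → K) :
    Fin.append (fstProj z) (sndProj z) = z := by
  ext i
  refine Fin.addCases (fun i => ?_) (fun i => ?_) i
  · exact congrFun (fst_append (fstProj z) (sndProj z)) i
  · exact congrFun (snd_append (fstProj z) (sndProj z)) i

theorem finrank_prodSub {K : Type} [Field K] {n : ℕ} (P M : Submodule K (Fin n → K)) :
    Module.finrank K (prodSub P M) = Module.finrank K P + Module.finrank K M := by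
  rw [← Module.finrank_prod]
  let g : prodSub P M →ₗ[K] P × M :=
    { toFun := fun w => (⟨fstProj w.1, w.2.1⟩, ⟨sndProj w.1, w.2.2⟩)
      map_add' := fun _ _ => rfl
      map_smul' := fun _ _ => rfl }
  refine LinearEquiv.finrank_eq (LinearEquiv.ofBijective g ⟨?_, ?_⟩)
  · intro a b h
    have h1 : fstProj a.1 = fstProj b.1 := congrArg (fun q : P × M => q.1.1) h
    have h2 : sndProj a.1 = sndProj b.1 := congrArg (fun q : P × M => q.2.1) h
    apply Subtype.ext
    rw [← append_proj a.1, ← append_proj b.1, h1, h2]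
  · rintro ⟨⟨x, hx⟩, ⟨y, hy⟩⟩
    refine ⟨⟨Fin.append x y, ?_, ?_⟩, ?_⟩
    · rw [fst_append]; exact hx
    · rw [snd_append]; exact hy
    · apply Prod.ext
      · exact Subtype.ext (fst_append x y)
      · exact Subtype.ext (snd_append x y)

theorem TV_eq_zeros {K : Type} [Field K] {n : ℕ} {V : Set (Fin n → K)} (h : IsAlgebraicSet V) :
    ∃ F : Set (MvPolynomial (Fin (n + n)) K), tangentBundle V = {z | ∀ f ∈ F, eval z f = 0} := by
  refine ⟨vanishingIdeal K (tangentBundle V), ?_⟩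
  ext z
  constructor
  · intro hz f hf
    exact hf z hz
  · intro hz
    refine ⟨alg_closed_eq h _ fun f hf => ?_, fun f hf => ?_⟩
    · have := hz _ (rename_mem_TV V f hf)
      rw [eval_rename] at this
      exact this
    · have := hz _ (deriv_mem_TV V f hf)
      rw [map_sum] at this
      rw [← this]
      refine Finset.sum_congr rfl fun i _ => ?_
      rw [map_mul, eval_rename, eval_X]
      rfl

/-- For a smooth irreducible algebraic variety `V ⊆ A^n`, `deg(TV) ≥ deg(V)`. -/
theorem degree_tangentBundle_ge {K : Type} [Field K] [IsAlgClosed K] [CharZero K]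
    {n : ℕ} (V : Set (Fin n → K)) (h1 : IsIrreducibleVariety V)
    (h2 : IsSmoothVariety V) :
    geomDegree V ≤ geomDegree (tangentBundle V) := by
  classical
  have hinf : Infinite K := IsAlgClosed.instInfinite
  obtain ⟨F, hF⟩ := TV_eq_zeros h1.1
  obtain ⟨B, hB⟩ := bound_affine F
  rw [← hF] at hB
  apply csSup_le'
  rintro m ⟨L, hL, hfin, hm⟩
  rcases Set.eq_empty_or_nonempty (V ∩ (L : Set (Fin n → K))) with he | ⟨p, hpV, hpL⟩
  · rw [he, Set.ncard_empty] at hm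
    rw [← hm]; exact Nat.zero_le _
  have hdn : varDim V ≤ n := by
    rw [← finrank_tanSub (h2 p hpV)]
    simpa using (tanSub V p).finrank_le
  obtain ⟨M, hM, hMd⟩ := common_compl (K := K) (E := Fin n → K)
    (hfin.toFinset.image (tanSub V))
    ⟨tanSub V p, Finset.mem_image_of_mem _ (hfin.mem_toFinset.2 ⟨hpV, hpL⟩)⟩ (varDim V)
    (by
      intro T hT
      obtain ⟨q, hq, rfl⟩ := Finset.mem_image.1 hT
      exact finrank_tanSub (h2 q (hfin.mem_toFinset.1 hq).1))
    (n - varDim V) (by simp; omega)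
  let L' := AffineSubspace.mk' (Fin.append p (0 : Fin n → K)) (prodSub L.direction M)
  have hset : tangentBundle V ∩ (L' : Set (Fin (n + n) → K)) =
      (fun x => Fin.append x (0 : Fin n → K)) '' (V ∩ (L : Set (Fin n → K))) := by
    ext z
    constructor
    · rintro ⟨hz, hzL⟩
      have hz' : z -ᵥ Fin.append p (0 : Fin n → K) ∈ prodSub L.direction M :=
        AffineSubspace.mem_mk'.1 hzL
      have ha : fstProj z - p ∈ L.direction := by
        have := hz'.1
        have e : fstProj (z -ᵥ Fin.append p (0 : Fin n → K)) = fstProj z - p := by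
          conv_rhs => rw [← fst_append p (0 : Fin n → K)]
          rfl
        rwa [e] at this
      have hb : sndProj z ∈ M := by
        have := hz'.2
        have e : sndProj (z -ᵥ Fin.append p (0 : Fin n → K)) = sndProj z - 0 := by
          conv_rhs => rw [← snd_append p (0 : Fin n → K)]
          rfl
        rwa [e, sub_zero] at this
      have hzL : fstProj z ∈ L := (AffineSubspace.vsub_right_mem_direction_iff_mem hpL _).1 ha
      have h0 : sndProj z = 0 := hMd (tanSub V (fstProj z))
        (Finset.mem_image_of_mem _ (hfin.mem_toFinset.2 ⟨hz.1, hzL⟩)) _ hb hz.2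
      refine ⟨fstProj z, ⟨hz.1, hzL⟩, ?_⟩
      show Fin.append (fstProj z) 0 = z
      rw [← h0, append_proj]
    · rintro ⟨x, ⟨hxV, hxL⟩, rfl⟩
      refine ⟨⟨?_, ?_⟩, ?_⟩
      · rw [fst_append]; exact hxV
      · rw [fst_append, snd_append]; exact (tanSub V x).zero_mem
      · refine AffineSubspace.mem_mk'.2 ⟨?_, ?_⟩
        · have e : fstProj (Fin.append x (0 : Fin n → K) -ᵥ Fin.append p (0 : Fin n → K)) =
              x - p := by
            conv_rhs => rw [← fst_append p (0 : Fin n → K), ← fst_append x (0 : Fin n → K)]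
            rfl
          rw [e]
          exact (AffineSubspace.vsub_right_mem_direction_iff_mem hpL _).2 hxL
        · have e : sndProj (Fin.append x (0 : Fin n → K) -ᵥ Fin.append p (0 : Fin n → K)) =
              0 - 0 := by
            conv_rhs =>
              congr
              · rw [← snd_append x (0 : Fin n → K)]
              · rw [← snd_append p (0 : Fin n → K)]
            rfl
          rw [e, sub_zero]
          exact M.zero_mem
  have hinj : Function.Injective (fun x : Fin n → K => Fin.append x (0 : Fin n → K)) := by
    intro x x' h
    have := congrArg fstProj h
    simpa only [fst_append] using this
  refine le_csSup ⟨B, ?_⟩ ⟨L', ?_, ?_, ?_⟩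
  · rintro m' ⟨L'', -, hf, rfl⟩
    exact hB L'' hf
  · rw [AffineSubspace.direction_mk', finrank_prodSub, hL, hM, varDim_TV V h1 h2]
    omega
  · rw [hset]; exact hfin.image _
  · rw [hset, Set.ncard_image_of_injective _ hinj, hm]
end
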